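/- Let Q = ℝⁿ × (0,∞), let L be a nondivergence parabolic operator on Q with ellipticity constant ν ∈ (0,1], let (ω^X) be the L-caloric measure for Q, and fix a constant K ≥ 1. Then there exists a constant N = N(n, ν, K) such that for every r > 0 and every X = (x,t) ∈ Q with |x| ≤ K√t, one has ω^X(Δ_{2r}) ≤ N · ω^X(Δ_r), where Δ_r = B_r(0) × {0} ⊂ ℝⁿ × {0} = ∂_p Q. -/

import Mathlib

open MeasureTheory Set Metric Filter

noncomputable section

/-- Euclidean space `ℝⁿ`. -/
abbrev E (n : ℕ) : Type := EuclideanSpace ℝ (Fin n)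

/-- Second spatial partial derivative `D_i D_j u` at a space-time point `X`. -/
def D2 {n : ℕ} (u : E n × ℝ → ℝ) (X : E n × ℝ) (i j : Fin n) : ℝ :=
  fderiv ℝ (fun x => fderiv ℝ (fun x' => u (x', X.2)) x (EuclideanSpace.single j 1))
    X.1 (EuclideanSpace.single i 1)

/-- Time derivative `D_t u` at a space-time point `X`. -/
def Dt {n : ℕ} (u : E n × ℝ → ℝ) (X : E n × ℝ) : ℝ :=
  deriv (fun t => u (X.1, t)) X.2

/-- The value `Lu(X)` of the nondivergence parabolic operator with coefficients `a`. -/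
def LVal {n : ℕ} (a : E n × ℝ → Fin n → Fin n → ℝ) (u : E n × ℝ → ℝ) (X : E n × ℝ) : ℝ :=
  (∑ i, ∑ j, a X i j * D2 u X i j) - Dt u X

/-- `u` is C² in `x` and C¹ in `t` at every point of `V`. -/
def ParabolicSmoothOn {n : ℕ} (u : E n × ℝ → ℝ) (V : Set (E n × ℝ)) : Prop :=
  ∀ X ∈ V, ContDiffAt ℝ 2 (fun x => u (x, X.2)) X.1 ∧
    DifferentiableAt ℝ (fun t => u (X.1, t)) X.2

/-- `u` solves `Lu = 0` pointwise in `V` (being C² in `x`, C¹ in `t` there). -/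
def SolvesL {n : ℕ} (a : E n × ℝ → Fin n → Fin n → ℝ) (u : E n × ℝ → ℝ)
    (V : Set (E n × ℝ)) : Prop :=
  ParabolicSmoothOn u V ∧ ∀ X ∈ V, LVal a u X = 0

/-- `a` is a smooth coefficient matrix on `S`, uniformly elliptic with constant `ν`
and with entries bounded by `ν⁻¹`. -/
def IsParabolicCoeff {n : ℕ} (ν : ℝ) (a : E n × ℝ → Fin n → Fin n → ℝ)
    (S : Set (E n × ℝ)) : Prop :=
  (∀ i j, ContDiffOn ℝ (⊤ : ℕ∞) (fun X => a X i j) S) ∧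
  ∀ X ∈ S, (∀ ξ : Fin n → ℝ, ν * ∑ i, ξ i ^ 2 ≤ ∑ i, ∑ j, a X i j * ξ i * ξ j) ∧
    ∀ i j, |a X i j| ≤ ν⁻¹

/-- The cylinder `Ω × (t₀, ∞)`. -/
def CylFrom {n : ℕ} (Ω : Set (E n)) (t₀ : ℝ) : Set (E n × ℝ) := Ω ×ˢ Ioi t₀

/-- The cylinder `Q = Ω × (0, ∞)`. -/
def Cyl {n : ℕ} (Ω : Set (E n)) : Set (E n × ℝ) := CylFrom Ω 0

/-- Parabolic boundary of the cylinder `Ω × (t₀, ∞)`: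
`(∂Ω × (t₀,∞)) ∪ (cl(Ω) × {t₀})`. -/
def pBFrom {n : ℕ} (Ω : Set (E n)) (t₀ : ℝ) : Set (E n × ℝ) :=
  (frontier Ω ×ˢ Ioi t₀) ∪ (closure Ω ×ˢ {t₀})

/-- Parabolic boundary of `Ω × (0, ∞)`. -/
def pB {n : ℕ} (Ω : Set (E n)) : Set (E n × ℝ) := pBFrom Ω 0

/-- The cylinder `C_{R,r}(Y) = B_R(y) × (s - r², s + r²)`. -/
def CRr {n : ℕ} (Y : E n × ℝ) (R r : ℝ) : Set (E n × ℝ) :=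
  ball Y.1 R ×ˢ Ioo (Y.2 - r ^ 2) (Y.2 + r ^ 2)

/-- The standard cylinder `C_r(Y) = B_r(y) × (s - r², s + r²)`. -/
def Cr {n : ℕ} (Y : E n × ℝ) (r : ℝ) : Set (E n × ℝ) := CRr Y r r

/-- `ω` is the `L`-caloric measure family for the cylinder `Ω × (t₀, ∞)`:
each `ω X` is a Borel probability measure on the parabolic boundary, and for every
bounded continuous `φ`, `X ↦ ∫ φ dω^X` is a (bounded) solution of `Lu = 0` in the
cylinder extending continuously to `φ` at each point of the parabolic boundary. -/
def IsCaloricMeasureFrom {n : ℕ} (a : E n × ℝ → Fin n → Fin n → ℝ) (Ω : Set (E n))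
    (t₀ : ℝ) (ω : E n × ℝ → Measure (E n × ℝ)) : Prop :=
  (∀ X ∈ CylFrom Ω t₀, IsProbabilityMeasure (ω X) ∧ ω X (pBFrom Ω t₀)ᶜ = 0) ∧
  ∀ φ : E n × ℝ → ℝ, Continuous φ → (∃ M, ∀ z, |φ z| ≤ M) →
    SolvesL a (fun X => ∫ z, φ z ∂ω X) (CylFrom Ω t₀) ∧
    ∀ Z ∈ pBFrom Ω t₀, Tendsto (fun X => ∫ z, φ z ∂ω X)
      (nhdsWithin Z (CylFrom Ω t₀)) (nhds (φ Z))

/-- `ω` is the `L`-caloric measure family for `Q = Ω × (0, ∞)`. -/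
def IsCaloricMeasure {n : ℕ} (a : E n × ℝ → Fin n → Fin n → ℝ) (Ω : Set (E n))
    (ω : E n × ℝ → Measure (E n × ℝ)) : Prop :=
  IsCaloricMeasureFrom a Ω 0 ω

/-- `Ω` is a Lipschitz domain with constants `m, r₀ > 0`: it is a nonempty open
connected set and near each boundary point, in a suitable orthonormal coordinate
system centered at that point, it coincides with the region above the graph of a
function with `‖∇φ‖_{L^∞} ≤ m` (equivalently, `m`-Lipschitz). -/
def IsLipschitzDomain {n : ℕ} (hn : 0 < n) (Ω : Set (E n)) (m r₀ : ℝ) : Prop :=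
  IsOpen Ω ∧ Ω.Nonempty ∧ IsConnected Ω ∧ 0 < m ∧ 0 < r₀ ∧
  ∀ y ∈ frontier Ω, ∃ (T : E n ≃ₗᵢ[ℝ] E n) (φ : E (n - 1) → ℝ),
    LipschitzWith m.toNNReal φ ∧
    ∀ x : E n, x ∈ Ω ∩ ball y r₀ ↔
      ‖x - y‖ < r₀ ∧
        φ ((EuclideanSpace.equiv (Fin (n - 1)) ℝ).symm
            (fun i => T (x - y) (Fin.castLE (Nat.sub_le n 1) i))) <
          T (x - y) ⟨n - 1, Nat.sub_lt hn Nat.one_pos⟩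

/-- The set `Ω^δ = {x ∈ Ω : dist(x, ∂Ω) > δ}`. -/
def innerSet {n : ℕ} (Ω : Set (E n)) (δ : ℝ) : Set (E n) :=
  {x ∈ Ω | δ < infDist x (frontier Ω)}

/-- The corkscrew property (2.3) with constant `μ`. -/
def Corkscrew {n : ℕ} (Ω : Set (E n)) (r₀ μ : ℝ) : Prop :=
  ∀ y ∈ frontier Ω, ∀ r : ℝ, 0 < r → r < r₀ →
    (∃ y₁ : E n, ball y₁ (2 * μ * r) ⊆ ball y r ∩ Ω) ∧
    (∃ y₂ : E n, ball y₂ (2 * μ * r) ⊆ ball y r \ Ω)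



/-- Regularity at a point. -/
def Reg {n : ℕ} (f : E n × ℝ → ℝ) (X : E n × ℝ) : Prop :=
  ContDiffAt ℝ 2 (fun x => f (x, X.2)) X.1 ∧ DifferentiableAt ℝ (fun t => f (X.1, t)) X.2

lemma fderiv_diff_of_C2 {n : ℕ} {s : E n → ℝ} {x : E n} (h : ContDiffAt ℝ 2 s x) :
    DifferentiableAt ℝ (fderiv ℝ s) x := by
  have := ContDiffAt.fderiv_right (m := 1) h (by norm_num)
  exact this.differentiableAt (by norm_num)

lemma ev_diff_of_C2 {n : ℕ} {s : E n → ℝ} {x : E n} (h : ContDiffAt ℝ 2 s x) :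
    ∀ᶠ y in nhds x, DifferentiableAt ℝ s y := by
  have := h.eventually (by simp)
  filter_upwards [this] with y hy
  exact hy.differentiableAt (by norm_num)

lemma D2_eq {n : ℕ} {f : E n × ℝ → ℝ} {X : E n × ℝ}
    (h : ContDiffAt ℝ 2 (fun x => f (x, X.2)) X.1) (i j : Fin n) :
    D2 f X i j = fderiv ℝ (fderiv ℝ (fun x => f (x, X.2))) X.1 (EuclideanSpace.single i 1)
      (EuclideanSpace.single j 1) := by
  unfold D2
  rw [fderiv_clm_apply (fderiv_diff_of_C2 h) (by fun_prop)]
  simp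

lemma fderiv2_add {n : ℕ} {s r : E n → ℝ} {x : E n} (hs : ContDiffAt ℝ 2 s x)
    (hr : ContDiffAt ℝ 2 r x) :
    fderiv ℝ (fderiv ℝ (fun y => s y + r y)) x
      = fderiv ℝ (fderiv ℝ s) x + fderiv ℝ (fderiv ℝ r) x := by
  have : fderiv ℝ (fun y => s y + r y) =ᶠ[nhds x] fun y => fderiv ℝ s y + fderiv ℝ r y := by
    filter_upwards [ev_diff_of_C2 hs, ev_diff_of_C2 hr] with y h1 h2
    exact fderiv_fun_add h1 h2
  rw [this.fderiv_eq, fderiv_fun_add (fderiv_diff_of_C2 hs) (fderiv_diff_of_C2 hr)]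

lemma fderiv2_const_mul {n : ℕ} {s : E n → ℝ} {x : E n} (c : ℝ) (hs : ContDiffAt ℝ 2 s x) :
    fderiv ℝ (fderiv ℝ (fun y => c * s y)) x = c • fderiv ℝ (fderiv ℝ s) x := by
  have : fderiv ℝ (fun y => c * s y) =ᶠ[nhds x] fun y => c • fderiv ℝ s y := by
    filter_upwards [ev_diff_of_C2 hs] with y h1
    exact fderiv_const_mul h1 c
  rw [this.fderiv_eq, fderiv_fun_const_smul (fderiv_diff_of_C2 hs)]

lemma Reg.add {n : ℕ} {f g : E n × ℝ → ℝ} {X : E n × ℝ} (hf : Reg f X) (hg : Reg g X) :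
    Reg (fun Y => f Y + g Y) X := ⟨hf.1.add hg.1, hf.2.fun_add hg.2⟩

lemma Reg.const_mul {n : ℕ} {f : E n × ℝ → ℝ} {X : E n × ℝ} (c : ℝ) (hf : Reg f X) :
    Reg (fun Y => c * f Y) X := ⟨contDiffAt_const.mul hf.1, hf.2.const_mul c⟩

lemma Reg.const {n : ℕ} (X : E n × ℝ) (c : ℝ) : Reg (fun _ => c) X :=
  ⟨contDiffAt_const, differentiableAt_const _⟩

lemma Reg.sum {n : ℕ} {ι : Type*} (s : Finset ι) {f : ι → E n × ℝ → ℝ} {X : E n × ℝ}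
    (hf : ∀ i ∈ s, Reg (f i) X) : Reg (fun Y => ∑ i ∈ s, f i Y) X :=
  ⟨ContDiffAt.sum fun i hi => (hf i hi).1, DifferentiableAt.fun_sum fun i hi => (hf i hi).2⟩

lemma LVal_add {n : ℕ} (a : E n × ℝ → Fin n → Fin n → ℝ) {f g : E n × ℝ → ℝ} {X : E n × ℝ}
    (hf : Reg f X) (hg : Reg g X) :
    LVal a (fun Y => f Y + g Y) X = LVal a f X + LVal a g X := by
  have h1 : ∀ i j, D2 (fun Y => f Y + g Y) X i j = D2 f X i j + D2 g X i j := by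
    intro i j
    rw [D2_eq (hf.add hg).1, D2_eq hf.1, D2_eq hg.1, fderiv2_add hf.1 hg.1]
    rfl
  have h2 : Dt (fun Y => f Y + g Y) X = Dt f X + Dt g X := deriv_fun_add hf.2 hg.2
  unfold LVal
  simp only [h1, h2, mul_add, Finset.sum_add_distrib]
  ring

lemma LVal_const_mul {n : ℕ} (a : E n × ℝ → Fin n → Fin n → ℝ) {f : E n × ℝ → ℝ} {X : E n × ℝ}
    (c : ℝ) (hf : Reg f X) :
    LVal a (fun Y => c * f Y) X = c * LVal a f X := by
  have h1 : ∀ i j, D2 (fun Y => c * f Y) X i j = c * D2 f X i j := by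
    intro i j
    rw [D2_eq (hf.const_mul c).1, D2_eq hf.1, fderiv2_const_mul c hf.1]
    rfl
  have h2 : Dt (fun Y => c * f Y) X = c * Dt f X := deriv_const_mul c hf.2
  unfold LVal
  simp only [h1, h2, mul_sub, Finset.mul_sum]
  congr 1
  refine Finset.sum_congr rfl fun i _ => Finset.sum_congr rfl fun j _ => by ring

lemma LVal_const {n : ℕ} (a : E n × ℝ → Fin n → Fin n → ℝ) (X : E n × ℝ) (c : ℝ) :
    LVal a (fun _ => c) X = 0 := by
  unfold LVal D2 Dt
  simp

lemma LVal_sum {n : ℕ} (a : E n × ℝ → Fin n → Fin n → ℝ) {ι : Type*} (s : Finset ι)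
    {f : ι → E n × ℝ → ℝ} {X : E n × ℝ} (hf : ∀ i ∈ s, Reg (f i) X) :
    LVal a (fun Y => ∑ i ∈ s, f i Y) X = ∑ i ∈ s, LVal a (f i) X := by
  classical
  induction s using Finset.induction_on with
  | empty => simpa using LVal_const a X 0
  | insert i s hi ih =>
    simp only [Finset.sum_insert hi]
    rw [LVal_add a (hf i (by simp)) (Reg.sum s fun k hk => hf k (by simp [hk])),
      ih fun k hk => hf k (by simp [hk])]

/-- second order necessary condition along a line -/
lemma second_nonneg_of_localMin {n : ℕ} {s : E n → ℝ} {x : E n} (h : ContDiffAt ℝ 2 s x)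
    (hm : IsLocalMin s x) (v : E n) : 0 ≤ fderiv ℝ (fderiv ℝ s) x v v := by
  by_contra hneg
  push Not at hneg
  set g : ℝ → ℝ := fun τ => s (x + τ • v) with hg
  have hline : ∀ τ : ℝ, HasDerivAt (fun τ : ℝ => x + τ • v) v τ := by
    intro τ
    simpa using ((hasDerivAt_id τ).smul_const v).const_add x
  have hcont : Tendsto (fun τ : ℝ => x + τ • v) (nhds 0) (nhds x) := by
    have := (hline 0).continuousAt.tendsto
    simpa using this
  have hd : deriv g =ᶠ[nhds 0] fun τ => fderiv ℝ s (x + τ • v) v := by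
    filter_upwards [hcont.eventually (ev_diff_of_C2 h)] with τ hτ
    exact (hτ.hasFDerivAt.comp_hasDerivAt τ (hline τ)).deriv
  have hdd : deriv (deriv g) 0 = fderiv ℝ (fderiv ℝ s) x v v := by
    rw [hd.deriv_eq]
    have h0 : HasFDerivAt (fderiv ℝ s) (fderiv ℝ (fderiv ℝ s) x) (x + (0:ℝ) • v) := by
      rw [zero_smul, add_zero]
      exact (fderiv_diff_of_C2 h).hasFDerivAt
    have h1 : HasFDerivAt (fun y => fderiv ℝ s y v)
        ((ContinuousLinearMap.apply ℝ ℝ v).comp (fderiv ℝ (fderiv ℝ s) x)) (x + (0:ℝ) • v) :=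
      (ContinuousLinearMap.apply ℝ ℝ v).hasFDerivAt.comp _ h0
    have h2 := h1.comp_hasDerivAt (0:ℝ) (hline 0)
    exact h2.deriv
  have hgmin : IsLocalMin g 0 := by
    have := hcont.eventually hm
    filter_upwards [this] with τ hτ
    simpa [hg] using hτ
  have hgc : ContinuousAt g 0 := by
    have : ContinuousAt s (x + (0:ℝ) • v) := by simpa using h.continuousAt
    exact ContinuousAt.comp this (hline 0).continuousAt
  have hmax : IsLocalMax g 0 :=
    isLocalMax_of_deriv_deriv_neg (by rw [hdd]; exact hneg) hgmin.deriv_eq_zero hgc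
  have hconst : g =ᶠ[nhds 0] fun _ => g 0 := by
    filter_upwards [hgmin, hmax] with τ h1 h2 using le_antisymm h2 h1
  have h1 : deriv g =ᶠ[nhds 0] fun _ => 0 := by
    have := hconst.deriv
    simpa using this
  have h2 := h1.deriv_eq
  rw [hdd] at h2
  simp at h2
  linarith

lemma trace_nonneg {n : ℕ} (A H : Fin n → Fin n → ℝ)
    (hA : ∀ ξ : Fin n → ℝ, 0 ≤ ∑ i, ∑ j, A i j * ξ i * ξ j)
    (hsym : ∀ i j, H i j = H j i)
    (hH : ∀ ξ : Fin n → ℝ, 0 ≤ ∑ i, ∑ j, H i j * ξ i * ξ j) :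
    0 ≤ ∑ i, ∑ j, A i j * H i j := by
  classical
  have hpsd : (Matrix.of H).PosSemidef := by
    refine Matrix.PosSemidef.of_dotProduct_mulVec_nonneg ?_ ?_
    · ext i j
      simp [Matrix.conjTranspose_apply, hsym i j]
    · intro x
      have := hH x
      simp only [dotProduct, Matrix.mulVec, Finset.mul_sum, Matrix.of_apply]
      refine this.trans_eq (Finset.sum_congr rfl fun i _ => Finset.sum_congr rfl fun j _ => ?_)
      simp; ring
  obtain ⟨C, hC⟩ : ∃ C : Matrix (Fin n) (Fin n) ℝ, Matrix.of H = C.conjTranspose * C := by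
    open scoped MatrixOrder ComplexOrder in
    exact (CStarAlgebra.nonneg_iff_eq_star_mul_self.mp hpsd.nonneg)
  have hh : ∀ i j, H i j = ∑ k, C k i * C k j := by
    intro i j
    have := congrFun (congrFun hC i) j
    simpa [Matrix.mul_apply, Matrix.conjTranspose_apply] using this
  have : ∑ i, ∑ j, A i j * H i j = ∑ k, ∑ i, ∑ j, A i j * C k i * C k j := by
    simp only [hh, Finset.mul_sum]
    rw [Finset.sum_comm]
    have h1 : ∀ j : Fin n, ∑ i, ∑ k, A i j * (C k i * C k j)
        = ∑ k, ∑ i, A i j * (C k i * C k j) := fun j => Finset.sum_comm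
    simp only [h1]
    rw [Finset.sum_comm]
    refine Finset.sum_congr rfl fun k _ => ?_
    rw [Finset.sum_comm]
    refine Finset.sum_congr rfl fun i _ => Finset.sum_congr rfl fun j _ => by ring
  rw [this]
  exact Finset.sum_nonneg fun k _ => hA (C k)

lemma LVal_nonneg_of_min {n : ℕ} {a : E n × ℝ → Fin n → Fin n → ℝ} {f : E n × ℝ → ℝ}
    {x : E n} {t t1 : ℝ} (hr : Reg f (x, t))
    (hA : ∀ ξ : Fin n → ℝ, 0 ≤ ∑ i, ∑ j, a (x, t) i j * ξ i * ξ j)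
    (hm : IsLocalMin (fun y => f (y, t)) x) (ht : t1 < t)
    (hpast : ∀ t' ∈ Ico t1 t, f (x, t) < f (x, t')) : 0 ≤ LVal a f (x, t) := by
  have h1 : 0 ≤ ∑ i, ∑ j, a (x, t) i j * D2 f (x, t) i j := by
    refine trace_nonneg _ _ hA ?_ ?_
    · intro i j
      rw [D2_eq hr.1, D2_eq hr.1]
      exact (hr.1.isSymmSndFDerivAt (by simp)) _ _
    · intro ξ
      have := second_nonneg_of_localMin hr.1 hm (∑ i, ξ i • EuclideanSpace.single i (1:ℝ))
      refine this.trans_eq ?_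
      simp only [map_sum, map_smul, sum_apply, smul_apply]
      simp only [D2_eq hr.1, smul_eq_mul, Finset.mul_sum]
      rw [Finset.sum_comm]
      refine Finset.sum_congr rfl fun i _ => Finset.sum_congr rfl fun j _ => by ring
  have h2 : Dt f (x, t) ≤ 0 := by
    by_contra hpos
    push Not at hpos
    have hd : HasDerivAt (fun τ => f (x, τ)) (Dt f (x, t)) t := hr.2.hasDerivAt
    have := (hasDerivAt_iff_tendsto_slope.mp hd).eventually (lt_mem_nhds hpos)
    have h3 : ∀ᶠ τ in nhdsWithin t (Iio t), 0 < slope (fun τ => f (x, τ)) t τ :=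
      this.filter_mono (nhdsWithin_mono _ (fun y hy => ne_of_lt hy))
    have h4 : ∀ᶠ τ in nhdsWithin t (Iio t), τ ∈ Ico t1 t := Ico_mem_nhdsLT ht
    obtain ⟨τ, h5, h6⟩ := (h3.and h4).exists
    have h7 := hpast τ h6
    rw [slope_def_field] at h5
    have : (f (x, τ) - f (x, t)) / (τ - t) < 0 :=
      div_neg_of_pos_of_neg (by linarith) (by linarith [h6.2])
    linarith
  unfold LVal
  linarith


/-- quadratic form -/
def qf {n : ℕ} (b : Fin n → Fin n → ℝ) (ξ x : E n) : ℝ :=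
  ∑ i, ∑ j, b i j * (x i - ξ i) * (x j - ξ j)

/-- half gradient of `qf` -/
def qg {n : ℕ} (b : Fin n → Fin n → ℝ) (ξ x : E n) (i : Fin n) : ℝ :=
  ∑ j, b i j * (x j - ξ j)

lemma qf_contDiff {n : ℕ} (b : Fin n → Fin n → ℝ) (ξ : E n) (m : WithTop ℕ∞) :
    ContDiff ℝ m (qf b ξ) := by
  unfold qf
  fun_prop

lemma hasFDerivAt_coord {n : ℕ} (i : Fin n) (y : E n) :
    HasFDerivAt (fun z : E n => z i) (EuclideanSpace.proj i : E n →L[ℝ] ℝ) y :=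
  (EuclideanSpace.proj i : E n →L[ℝ] ℝ).hasFDerivAt

lemma hasFDerivAt_qg {n : ℕ} (b : Fin n → Fin n → ℝ) (ξ y : E n) (i : Fin n) :
    HasFDerivAt (fun z => qg b ξ z i) (∑ j, b i j • (EuclideanSpace.proj j : E n →L[ℝ] ℝ)) y := by
  unfold qg
  exact HasFDerivAt.fun_sum fun j _ => ((hasFDerivAt_coord j y).sub_const _).const_mul _

lemma hasFDerivAt_qf {n : ℕ} (b : Fin n → Fin n → ℝ) (hb : ∀ i j, b i j = b j i) (ξ y : E n) :
    HasFDerivAt (qf b ξ) (∑ i, (2 * qg b ξ y i) • (EuclideanSpace.proj i : E n →L[ℝ] ℝ)) y := by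
  have h1 : qf b ξ = fun z => ∑ i, (z i - ξ i) * qg b ξ z i := by
    funext z
    unfold qf qg
    refine Finset.sum_congr rfl fun i _ => ?_
    rw [Finset.mul_sum]
    exact Finset.sum_congr rfl fun j _ => by ring
  rw [h1]
  have h2 : HasFDerivAt (fun z : E n => ∑ i, (z i - ξ i) * qg b ξ z i) _ y :=
    HasFDerivAt.fun_sum fun i _ => (((hasFDerivAt_coord i y).sub_const (ξ i)).mul (hasFDerivAt_qg b ξ y i))
  refine h2.congr_fderiv ?_
  ext v
  simp only [sum_apply, add_apply, smul_apply, smul_eq_mul, Finset.sum_add_distrib, two_mul,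
    add_mul, Finset.mul_sum]
  rw [add_comm]
  congr 1
  simp only [qg, Finset.sum_mul]
  rw [Finset.sum_comm]
  refine Finset.sum_congr rfl fun i _ => Finset.sum_congr rfl fun j _ => ?_
  rw [hb i j]; ring

lemma comp_qf {n : ℕ} (a : E n × ℝ → Fin n → Fin n → ℝ) (b : Fin n → Fin n → ℝ)
    (hb : ∀ i j, b i j = b j i) (ξ x : E n) (t : ℝ) (V : E n × ℝ → ℝ) (h h1 : ℝ → ℝ) (h2 vt : ℝ)
    (hV : ∀ y, V (y, t) = h (qf b ξ y)) (hc : ContDiffAt ℝ 2 h (qf b ξ x))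
    (hh1 : ∀ᶠ w in nhds (qf b ξ x), HasDerivAt h (h1 w) w)
    (hh2 : HasDerivAt h1 h2 (qf b ξ x))
    (ht : HasDerivAt (fun τ => V (x, τ)) vt t) :
    Reg V (x, t) ∧ LVal a V (x, t) =
      h2 * (4 * ∑ i, ∑ j, a (x, t) i j * qg b ξ x i * qg b ξ x j)
       + h1 (qf b ξ x) * (2 * ∑ i, ∑ j, a (x, t) i j * b i j) - vt := by
  have hs : (fun y => V (y, t)) = fun y => h (qf b ξ y) := funext hV
  have hreg : Reg V (x, t) := by
    refine ⟨?_, ht.differentiableAt⟩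
    show ContDiffAt ℝ 2 (fun y => V (y, t)) x
    rw [hs]
    exact ContDiffAt.comp x hc (qf_contDiff b ξ 2).contDiffAt
  refine ⟨hreg, ?_⟩
  have hD : ∀ i j, D2 V (x, t) i j
      = h2 * (4 * (qg b ξ x i * qg b ξ x j)) + h1 (qf b ξ x) * (2 * b i j) := by
    intro i j
    unfold D2
    simp only [hs]
    have hcont : Tendsto (qf b ξ) (nhds x) (nhds (qf b ξ x)) :=
      (qf_contDiff b ξ 0).continuous.tendsto x
    have hev : (fun y => fderiv ℝ (fun y => h (qf b ξ y)) y (EuclideanSpace.single j 1))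
        =ᶠ[nhds x] fun y => h1 (qf b ξ y) * (2 * qg b ξ y j) := by
      filter_upwards [hcont.eventually hh1] with y hy
      have := (hy.comp_hasFDerivAt y (hasFDerivAt_qf b hb ξ y)).fderiv
      have h3 : fderiv ℝ (fun y => h (qf b ξ y)) y = _ := this
      rw [h3]
      simp [sum_apply, EuclideanSpace.single_apply]
    rw [hev.fderiv_eq]
    have h3 : HasFDerivAt (fun y => h1 (qf b ξ y) * (2 * qg b ξ y j)) _ x :=
      (hh2.comp_hasFDerivAt x (hasFDerivAt_qf b hb ξ x)).mul ((hasFDerivAt_qg b ξ x j).const_mul 2)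
    rw [h3.fderiv]
    simp [sum_apply, EuclideanSpace.single_apply, hb j i]
    ring
  unfold LVal
  simp only [hD]
  have : Dt V (x, t) = vt := ht.deriv
  rw [this]
  congr 1
  simp only [mul_add, Finset.sum_add_distrib, Finset.mul_sum]
  congr 1 <;>
  · refine Finset.sum_congr rfl fun i _ => Finset.sum_congr rfl fun j _ => by ring


lemma CL {n : ℕ} {f : E n × ℝ → ℝ} {y : E n} {R t1 s : ℝ}
    (hslice : ∀ t ∈ Icc t1 s, ContinuousOn (fun x => f (x, t)) (closedBall y R))
    (hlsc : ∀ x ∈ closedBall y R, ∀ t ∈ Icc t1 s, ∀ c < f (x, t),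
      ∀ᶠ Y in nhdsWithin (x, t) {Y : E n × ℝ | t ≤ Y.2}, c < f Y)
    (hbot : ∀ x ∈ closedBall y R, 0 ≤ f (x, t1))
    (hlat : ∀ x ∈ sphere y R, ∀ t ∈ Icc t1 s, 0 ≤ f (x, t))
    (hloc : ∀ x ∈ ball y R, ∀ t ∈ Ioc t1 s, IsLocalMin (fun x' => f (x', t)) x →
      ∃ t' ∈ Ico t1 t, f (x, t') ≤ f (x, t)) :
    ∀ x ∈ closedBall y R, ∀ t ∈ Icc t1 s, 0 ≤ f (x, t) := by
  intro x0 hx0 t0 ht0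
  by_contra hneg
  push Not at hneg
  set μ := f (x0, t0) with hμ
  set T : Set ℝ := {t | t ∈ Icc t1 t0 ∧ ∃ x ∈ closedBall y R, f (x, t) ≤ μ} with hT
  have hTne : T.Nonempty := ⟨t0, ⟨ht0.1, le_rfl⟩, x0, hx0, le_rfl⟩
  have hTbdd : BddBelow T := ⟨t1, fun t ht => ht.1.1⟩
  set τ := sInf T with hτ
  have hτ1 : τ ∈ Icc t1 t0 :=
    ⟨le_csInf hTne fun t ht => ht.1.1, csInf_le hTbdd ⟨⟨ht0.1, le_rfl⟩, x0, hx0, le_rfl⟩⟩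
  have hτs : τ ∈ Icc t1 s := ⟨hτ1.1, hτ1.2.trans ht0.2⟩
  have hτT : ∃ x ∈ closedBall y R, f (x, τ) ≤ μ := by
    by_contra hcon
    push Not at hcon
    have hK : IsCompact (closedBall y R) := isCompact_closedBall y R
    have key : ∀ᶠ t in nhds τ, ∀ x ∈ closedBall y R, τ ≤ t → μ < f (x, t) := by
      refine hK.eventually_forall_of_forall_eventually ?_
      intro x hx
      have h1 := hlsc x hx τ hτs μ (hcon x hx)
      rw [eventually_nhdsWithin_iff] at h1
      have h2 : Tendsto (fun z : ℝ × E n => (z.2, z.1)) (nhds (τ, x)) (nhds (x, τ)) :=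
        (continuous_snd.prodMk continuous_fst).tendsto _
      exact h2.eventually h1
    have hcl := csInf_mem_closure hTne hTbdd
    rw [mem_closure_iff_frequently] at hcl
    obtain ⟨t, ht, ht'⟩ := (hcl.and_eventually key).exists
    obtain ⟨x, hx, hxt⟩ := ht.2
    have := ht' x hx (csInf_le hTbdd ht)
    linarith
  obtain ⟨x1, hx1, hx1μ⟩ := hτT
  obtain ⟨xm, hxm, hmin⟩ := (isCompact_closedBall y R).exists_isMinOn ⟨x1, hx1⟩ (hslice τ hτs)
  have hval : f (xm, τ) ≤ μ := (hmin hx1).trans hx1μ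
  have hIntg : xm ∈ ball y R := by
    rcases (mem_closedBall.mp hxm).lt_or_eq with h | h
    · exact h
    · have := hlat xm h τ hτs
      linarith
  have hτgt : t1 < τ := by
    rcases hτ1.1.lt_or_eq with h | h
    · exact h
    · have := hbot xm hxm
      rw [h] at this
      linarith
  have hloc' : IsLocalMin (fun x' => f (x', τ)) xm :=
    hmin.isLocalMin (Filter.mem_of_superset (isOpen_ball.mem_nhds hIntg) ball_subset_closedBall)
  obtain ⟨t', ht', hle⟩ := hloc xm hIntg τ ⟨hτgt, hτs.2⟩ hloc'
  have : t' ∈ T := ⟨⟨ht'.1, ht'.2.le.trans hτ1.2⟩, xm, hxm, hle.trans hval⟩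
  have := csInf_le hTbdd this
  linarith [ht'.2]


set_option maxHeartbeats 1000000 in
lemma ker_scalar {N A B C s σ q P W : ℝ} (hN : 0 ≤ N) (hs : 0 < s) (hσs : s ≤ σ) (hq : q = σ ^ 2 - s ^ 2)
    (hσ1 : σ ≤ 1) (hC : 0 ≤ C) (hB : 0 < B) (hBσ : B * σ ≤ 1 / 9) (hBC : 4 ≤ 7 * B / 4 - C / 4)
    (hP : P ≤ 4 * q + C * σ * q) (hP0 : 0 ≤ P) (hW : 2 * N - C * σ ≤ W)
    (hA : A = 2 * (B / 4 + 3 * B * (4 + C) / 16 + (3 * N * B + C) / 4 + 1) ^ 2) :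
    ((-(1 - 3 / 2 * B * σ) / (4 * s ^ 2)) ^ 2 + 3 / 4 * B / σ / (4 * s ^ 2)) * P
      + (-(1 - 3 / 2 * B * σ) / (4 * s ^ 2)) * W
      - (-(N / 2) / s ^ 2 + A / (2 * s) + (q - B * σ ^ 3) / (4 * (s ^ 2) ^ 2)
          + 3 / 2 * B * σ / (4 * s ^ 2)) ≤ 0 := by
  have hσ : 0 < σ := hs.trans_le hσs
  have hq0 : 0 ≤ q := by rw [hq]; nlinarith
  have hqσ : q ≤ σ ^ 2 := by rw [hq]; nlinarith
  set β := 3 / 2 * B * σ with hβ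
  have hβ0 : 0 < β := by positivity
  have hβ6 : β ≤ 1 / 6 := by rw [hβ]; linarith
  set c := B / 4 + 3 * B * (4 + C) / 16 + (3 * N * B + C) / 4 + 1 with hc
  have hc1 : 1 ≤ c := by
    have : 0 ≤ B / 4 + 3 * B * (4 + C) / 16 + (3 * N * B + C) / 4 := by positivity
    linarith
  -- T1
  have h1 : (1 - β) ^ 2 * P ≤ 4 * q - 11 * B * σ * q + C * σ * q := by
    have e1 : (1 - β) ^ 2 ≤ 1 - 11 / 6 * β := by nlinarith
    have e2 : (1 - β) ^ 2 * P ≤ (1 - β) ^ 2 * (4 * q + C * σ * q) :=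
      mul_le_mul_of_nonneg_left hP (sq_nonneg _)
    have hCq : 0 ≤ C * σ * q := by positivity
    have e3 : (1 - β) ^ 2 * (4 * q + C * σ * q) ≤ (1 - 11 / 6 * β) * (4 * q + C * σ * q) :=
      mul_le_mul_of_nonneg_right e1 (by positivity)
    have e4 : (1 - 11 / 6 * β) * (C * σ * q) ≤ C * σ * q := by nlinarith [mul_nonneg hβ0.le hCq]
    have e5 : (1 - 11 / 6 * β) * (4 * q) = 4 * q - 11 * B * σ * q := by rw [hβ]; ring
    linarith
  have h2 : 3 / 4 * B / σ * P ≤ 3 / 4 * B * (4 + C) * σ := by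
    have e1 : P ≤ (4 + C) * σ ^ 2 := by
      have : C * σ * q ≤ C * 1 * σ ^ 2 := by gcongr
      nlinarith
    calc 3 / 4 * B / σ * P ≤ 3 / 4 * B / σ * ((4 + C) * σ ^ 2) := by gcongr
      _ = 3 / 4 * B * (4 + C) * σ := by field_simp
  have h3 : -(1 - β) * W ≤ -2 * N + (3 * N * B + C) * σ := by
    have e1 : (1 - β) * (2 * N - C * σ) ≤ (1 - β) * W :=
      mul_le_mul_of_nonneg_left hW (by linarith)
    have e2 : 0 ≤ β * (C * σ) := by positivity
    have e3 : β * (2 * N) = 3 * N * B * σ := by rw [hβ]; ring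
    linarith
  -- u-inequality
  have h4 : c * σ * s ^ 2 - σ ^ 3 ≤ c ^ 2 * s ^ 3 := by
    rcases le_total σ (c * s) with h | h
    · have : c * σ * s ^ 2 ≤ c * (c * s) * s ^ 2 := by gcongr
      have h0 : 0 ≤ σ ^ 3 := by positivity
      have h5 : c * (c * s) * s ^ 2 = c ^ 2 * s ^ 3 := by ring
      linarith
    · have e1 : c * s * s ≤ σ * σ := by
        apply mul_le_mul h hσs hs.le hσ.le
      have h5 : σ * (c * s * s) ≤ σ * (σ * σ) := by gcongr
      have h6 : c * σ * s ^ 2 ≤ σ ^ 3 := by linarith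
      have : 0 ≤ c ^ 2 * s ^ 3 := by positivity
      linarith
  -- combine, multiplied by 16 s^4
  have hid : 16 * s ^ 4 * (((-(1 - β) / (4 * s ^ 2)) ^ 2 + 3 / 4 * B / σ / (4 * s ^ 2)) * P
      + (-(1 - β) / (4 * s ^ 2)) * W
      - (-(N / 2) / s ^ 2 + A / (2 * s) + (q - B * σ ^ 3) / (4 * (s ^ 2) ^ 2)
          + β / (4 * s ^ 2))) = (1 - β) ^ 2 * P + 4 * s ^ 2 * (3 / 4 * B / σ * P)
      + 4 * s ^ 2 * (-(1 - β) * W) + 8 * N * s ^ 2 - 8 * A * s ^ 3 - 4 * (q - B * σ ^ 3)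
      - 4 * β * s ^ 2 := by
    field_simp
    ring
  have hfin : 16 * s ^ 4 * (((-(1 - β) / (4 * s ^ 2)) ^ 2 + 3 / 4 * B / σ / (4 * s ^ 2)) * P
      + (-(1 - β) / (4 * s ^ 2)) * W
      - (-(N / 2) / s ^ 2 + A / (2 * s) + (q - B * σ ^ 3) / (4 * (s ^ 2) ^ 2)
          + β / (4 * s ^ 2))) ≤ 0 := by
    rw [hid]
    have e2 : 4 * s ^ 2 * (3 / 4 * B / σ * P) ≤ 4 * s ^ 2 * (3 / 4 * B * (4 + C) * σ) := by gcongr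
    have e3 : 4 * s ^ 2 * (-(1 - β) * W) ≤ 4 * s ^ 2 * (-2 * N + (3 * N * B + C) * σ) := by gcongr
    have e4 : 0 ≤ 4 * β * s ^ 2 := by positivity
    have e5 : σ ^ 3 = σ * q + σ * s ^ 2 := by rw [hq]; ring
    have e6 : 16 * σ * q ≤ 4 * (7 * B / 4 - C / 4) * (σ * q) := by
      have h0 : 0 ≤ σ * q := by positivity
      have h5 := mul_le_mul_of_nonneg_right hBC h0
      linarith
    have e7 : 16 * (c * σ * s ^ 2) = 16 * σ * s ^ 2 + 4 * B * σ * s ^ 2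
      + 3 * B * (4 + C) * σ * s ^ 2 + 4 * (3 * N * B + C) * σ * s ^ 2 := by rw [hc]; ring
    have e8 : 8 * A * s ^ 3 = 16 * (c ^ 2 * s ^ 3) := by rw [hA]; ring
    rw [e8]
    have e9 : B * σ ^ 3 = B * σ * q + B * σ * s ^ 2 := by rw [e5]; ring
    linarith
  have hs4 : 0 < 16 * s ^ 4 := by positivity
  by_contra hcon
  push Not at hcon
  have := mul_pos hs4 hcon
  linarith


/-- The kernel supersolution. -/
def kG {n : ℕ} (A B : ℝ) (b : Fin n → Fin n → ℝ) (ξ : E n) (τ : ℝ) (Y : E n × ℝ) : ℝ :=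
  Real.exp (-((n:ℝ) / 2) * Real.log (Y.2 - τ) + A * √(Y.2 - τ)
    - (qf b ξ Y.1 - B * √(qf b ξ Y.1 + (Y.2 - τ)) ^ 3) / (4 * (Y.2 - τ)))

lemma sqrt3_deriv {u : ℝ → ℝ} {u' w : ℝ} (hu : HasDerivAt u u' w) (hpos : 0 < u w) :
    HasDerivAt (fun w => √(u w) ^ 3) (3 / 2 * √(u w) * u') w := by
  have h := (hu.sqrt hpos.ne').pow 3
  refine h.congr_deriv ?_
  have : 0 < √(u w) := Real.sqrt_pos.mpr hpos
  simp only [Nat.cast_ofNat, Nat.add_one_sub_one]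
  field_simp

lemma kG_LVal {n : ℕ} (a : E n × ℝ → Fin n → Fin n → ℝ) (A B : ℝ) (b : Fin n → Fin n → ℝ)
    (hb : ∀ i j, b i j = b j i) (ξ x : E n) (τ t' : ℝ) (ht : τ < t') (hq : 0 ≤ qf b ξ x) :
    Reg (kG A B b ξ τ) (x, t') ∧ LVal a (kG A B b ξ τ) (x, t') = kG A B b ξ τ (x, t') *
    (((-(1 - 3 / 2 * B * √(qf b ξ x + (t' - τ))) / (4 * (t' - τ))) ^ 2
        + 3 / 4 * B / √(qf b ξ x + (t' - τ)) / (4 * (t' - τ)))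
        * (4 * ∑ i, ∑ j, a (x, t') i j * qg b ξ x i * qg b ξ x j)
      + (-(1 - 3 / 2 * B * √(qf b ξ x + (t' - τ))) / (4 * (t' - τ)))
        * (2 * ∑ i, ∑ j, a (x, t') i j * b i j)
      - (-((n:ℝ) / 2) / (t' - τ) + A / (2 * √(t' - τ))
          + (qf b ξ x - B * √(qf b ξ x + (t' - τ)) ^ 3) / (4 * (t' - τ) ^ 2)
          + 3 / 2 * B * √(qf b ξ x + (t' - τ)) / (4 * (t' - τ)))) := by
  set t := t' - τ with htdef
  have ht0 : 0 < t := by rw [htdef]; linarith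
  set q := qf b ξ x with hqdef
  set c0 : ℝ := -((n:ℝ) / 2) * Real.log t + A * √t with hc0
  set ψ : ℝ → ℝ := fun w => c0 - (w - B * √(w + t) ^ 3) / (4 * t) with hψ
  set ψ1 : ℝ → ℝ := fun w => -(1 - 3 / 2 * B * √(w + t)) / (4 * t) with hψ1
  have hpos : ∀ᶠ w in nhds q, 0 < w + t := by
    have : ContinuousAt (fun w : ℝ => w + t) q := by fun_prop
    exact this.eventually (lt_mem_nhds (by show (0:ℝ) < q + t; linarith))
  have hψd : ∀ w, 0 < w + t → HasDerivAt ψ (ψ1 w) w := by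
    intro w hw
    have h1 := sqrt3_deriv ((hasDerivAt_id w).add_const t) hw
    have h2 := (((hasDerivAt_id w).sub (h1.const_mul B)).div_const (4 * t)).const_sub c0
    refine h2.congr_deriv ?_
    simp only [hψ1, id]
    ring
  have hψ1d : HasDerivAt ψ1 (3 / 4 * B / √(q + t) / (4 * t)) q := by
    have h1 := ((hasDerivAt_id q).add_const t).sqrt (by simp only [id]; linarith)
    have h2 := (((h1.const_mul (3 / 2 * B)).const_sub 1).neg).div_const (4 * t)
    refine h2.congr_deriv ?_
    have : 0 < √(q + t) := Real.sqrt_pos.mpr (by linarith)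
    simp only [id]
    field_simp
    ring
  have htime : HasDerivAt (fun T => kG A B b ξ τ (x, T)) (kG A B b ξ τ (x, t') *
      (-((n:ℝ) / 2) / t + A / (2 * √t) + (q - B * √(q + t) ^ 3) / (4 * t ^ 2)
          + 3 / 2 * B * √(q + t) / (4 * t))) t' := by
    have g0 : HasDerivAt (fun T : ℝ => T - τ) 1 t' := (hasDerivAt_id t').sub_const τ
    have g1 := (g0.log (by rw [← htdef]; exact ht0.ne')).const_mul (-((n:ℝ) / 2))
    have g2 := (g0.sqrt (by rw [← htdef]; exact ht0.ne')).const_mul A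
    have g3 := sqrt3_deriv (g0.const_add q) (by rw [← htdef]; linarith)
    have g4 := ((g3.const_mul B).const_sub q).div (g0.const_mul 4)
      (by rw [← htdef]; positivity)
    have g5 := ((g1.add g2).sub g4).exp
    refine g5.congr_deriv ?_
    have e : √t ≠ 0 := (Real.sqrt_pos.mpr ht0).ne'
    show kG A B b ξ τ (x, t') * _ = _
    congr 1
    simp only [← htdef]
    field_simp
    ring
  have key := comp_qf a b hb ξ x t' (kG A B b ξ τ) (fun w => Real.exp (ψ w))
    (fun w => Real.exp (ψ w) * ψ1 w)
    (Real.exp (ψ q) * ψ1 q * ψ1 q + Real.exp (ψ q) * (3 / 4 * B / √(q + t) / (4 * t))) _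
    (fun y => rfl) ?_ ?_ ?_ htime
  · refine ⟨key.1, ?_⟩
    rw [key.2]
    have e : Real.exp (ψ q) = kG A B b ξ τ (x, t') := rfl
    simp only [← hqdef, e, hψ1]
    ring
  · have : (fun w => Real.exp (ψ w)) = fun w => Real.exp (c0 - (w - B * √(w + t) ^ 3) / (4 * t)) := rfl
    rw [this]
    have hs : ContDiffAt ℝ 2 (fun w : ℝ => √(w + t)) q :=
      (contDiffAt_id.add contDiffAt_const).sqrt (by simp only [id]; linarith)
    exact (contDiffAt_const.sub ((contDiffAt_id.sub (contDiffAt_const.mul (hs.pow 3))).div_const _)).exp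
  · filter_upwards [hpos] with w hw
    exact (hψd w hw).exp
  · exact ((hψd q (by linarith)).exp).mul hψ1d


lemma sq_sum_le_card {n : ℕ} (z : Fin n → ℝ) : (∑ i, |z i|) ^ 2 ≤ n * ∑ i, z i ^ 2 := by
  have := sq_sum_le_card_mul_sum_sq (s := (Finset.univ : Finset (Fin n))) (f := fun i => |z i|)
  simpa using this

lemma frozen {n : ℕ} {ν : ℝ} (hν : ν ∈ Ioc (0:ℝ) 1) (A0 : Fin n → Fin n → ℝ)
    (hell : ∀ ξ : Fin n → ℝ, ν * ∑ i, ξ i ^ 2 ≤ ∑ i, ∑ j, A0 i j * ξ i * ξ j)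
    (hbd : ∀ i j, |A0 i j| ≤ ν⁻¹) :
    ∃ b : Fin n → Fin n → ℝ, (∀ i j, b i j = b j i) ∧
      (∀ ξ x : E n, ∑ i, ∑ j, A0 i j * qg b ξ x i * qg b ξ x j = qf b ξ x) ∧
      (∑ i, ∑ j, A0 i j * b i j = n) ∧
      (∀ ξ x : E n, ν * ∑ i, qg b ξ x i ^ 2 ≤ qf b ξ x) ∧
      (∀ ξ x : E n, qf b ξ x ≤ ‖x - ξ‖ ^ 2 / ν) ∧
      (∀ i j, |b i j| ≤ ν⁻¹) ∧
      (∀ ξ x : E n, ‖x - ξ‖ ^ 2 ≤ n ^ 2 / ν ^ 3 * qf b ξ x) := by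
  classical
  have hν0 : 0 < ν := hν.1
  set S : Matrix (Fin n) (Fin n) ℝ := Matrix.of fun i j => (A0 i j + A0 j i) / 2 with hS
  have hSform : ∀ z : Fin n → ℝ, ∑ i, ∑ j, S i j * z i * z j = ∑ i, ∑ j, A0 i j * z i * z j := by
    intro z
    have h1 : ∑ i, ∑ j, A0 j i * z i * z j = ∑ i, ∑ j, A0 i j * z i * z j := by
      rw [Finset.sum_comm]
      exact Finset.sum_congr rfl fun i _ => Finset.sum_congr rfl fun j _ => by ring
    have h2 : ∑ i, ∑ j, S i j * z i * z j
        = (∑ i, ∑ j, A0 i j * z i * z j + ∑ i, ∑ j, A0 j i * z i * z j) / 2 := by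
      rw [← Finset.sum_add_distrib, Finset.sum_div]
      refine Finset.sum_congr rfl fun i _ => ?_
      rw [← Finset.sum_add_distrib, Finset.sum_div]
      refine Finset.sum_congr rfl fun j _ => ?_
      simp only [hS, Matrix.of_apply]; ring
    rw [h2, h1]; ring
  have hSsym : S.transpose = S := by
    ext i j; simp [hS, add_comm]
  have hinj : ∀ v : Fin n → ℝ, S.mulVec v = 0 → v = 0 := by
    intro v hv
    have h1 := hell v
    rw [← hSform] at h1
    have h2 : ∑ i, ∑ j, S i j * v i * v j = ∑ i, v i * S.mulVec v i := by
      refine Finset.sum_congr rfl fun i _ => ?_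
      simp only [Matrix.mulVec, dotProduct, Finset.mul_sum]
      exact Finset.sum_congr rfl fun j _ => by ring
    rw [h2, hv] at h1
    simp only [Pi.zero_apply, mul_zero, Finset.sum_const_zero] at h1
    have h3 : ∑ i, v i ^ 2 ≤ 0 := by
      by_contra hc; push Not at hc; nlinarith
    have h4 : ∑ i, v i ^ 2 = 0 := le_antisymm h3 (Finset.sum_nonneg fun i _ => sq_nonneg _)
    rw [Finset.sum_eq_zero_iff_of_nonneg fun i _ => sq_nonneg _] at h4
    funext i
    simpa using h4 i (Finset.mem_univ i)
  have hdet : IsUnit S.det := by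
    rw [isUnit_iff_ne_zero]
    intro h0
    obtain ⟨v, hv, hv0⟩ := Matrix.exists_mulVec_eq_zero_iff.mpr h0
    exact hv (hinj v hv0)
  set b : Matrix (Fin n) (Fin n) ℝ := S⁻¹ with hb
  have hSb : S * b = 1 := Matrix.mul_nonsing_inv S hdet
  have hbsym : ∀ i j, b i j = b j i := by
    intro i j
    have : b.transpose = b := by rw [hb, Matrix.transpose_nonsing_inv, hSsym]
    exact (congrFun (congrFun this j) i)
  -- z = b w
  have hSz : ∀ (ξ x : E n) i, ∑ j, S i j * qg b ξ x j = x i - ξ i := by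
    intro ξ x i
    have h1 : S.mulVec (b.mulVec fun k => x k - ξ k) = fun k => x k - ξ k := by
      rw [Matrix.mulVec_mulVec, hSb, Matrix.one_mulVec]
    exact congrFun h1 i
  have hqz : ∀ ξ x : E n, qf b ξ x = ∑ i, (x i - ξ i) * qg b ξ x i := by
    intro ξ x
    unfold qf qg
    refine Finset.sum_congr rfl fun i _ => ?_
    rw [Finset.mul_sum]
    exact Finset.sum_congr rfl fun j _ => by ring
  have hi : ∀ ξ x : E n, ∑ i, ∑ j, A0 i j * qg b ξ x i * qg b ξ x j = qf b ξ x := by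
    intro ξ x
    rw [← hSform, hqz]
    refine Finset.sum_congr rfl fun i _ => ?_
    rw [← hSz ξ x i, Finset.sum_mul]
    exact Finset.sum_congr rfl fun j _ => by ring
  have hiii : ∀ ξ x : E n, ν * ∑ i, qg b ξ x i ^ 2 ≤ qf b ξ x := by
    intro ξ x
    rw [← hi]
    exact hell _
  have hnorm : ∀ ξ x : E n, ‖x - ξ‖ ^ 2 = ∑ i, (x i - ξ i) ^ 2 := by
    intro ξ x
    rw [EuclideanSpace.norm_sq_eq]
    simp
  refine ⟨b, hbsym, hi, ?_, hiii, ?_, ?_, ?_⟩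
  · have h1 : ∑ i, ∑ j, A0 i j * b i j = ∑ i, ∑ j, S i j * b i j := by
      have h2 : ∑ i, ∑ j, A0 j i * b i j = ∑ i, ∑ j, A0 i j * b i j := by
        rw [Finset.sum_comm]
        exact Finset.sum_congr rfl fun i _ => Finset.sum_congr rfl fun j _ => by rw [hbsym j i]
      have h3 : ∑ i, ∑ j, S i j * b i j
          = (∑ i, ∑ j, A0 i j * b i j + ∑ i, ∑ j, A0 j i * b i j) / 2 := by
        rw [← Finset.sum_add_distrib, Finset.sum_div]
        refine Finset.sum_congr rfl fun i _ => ?_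
        rw [← Finset.sum_add_distrib, Finset.sum_div]
        refine Finset.sum_congr rfl fun j _ => ?_
        simp only [hS, Matrix.of_apply]; ring
      rw [h3, h2]; ring
    rw [h1]
    have h4 : ∀ i, ∑ j, S i j * b i j = 1 := by
      intro i
      have := congrFun (congrFun hSb i) i
      rw [Matrix.mul_apply] at this
      simp only [Matrix.one_apply_eq] at this
      rw [← this]
      exact Finset.sum_congr rfl fun j _ => by rw [hbsym i j]
    simp [h4]
  · intro ξ x
    have h1 := hiii ξ x
    have h2 : qf b ξ x ^ 2 ≤ ‖x - ξ‖ ^ 2 * ∑ i, qg b ξ x i ^ 2 := by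
      rw [hqz, hnorm]
      exact Finset.sum_mul_sq_le_sq_mul_sq _ _ _
    rw [le_div_iff₀ hν0]
    have hq0 : 0 ≤ qf b ξ x :=
      le_trans (mul_nonneg hν0.le (Finset.sum_nonneg fun i _ => sq_nonneg _)) h1
    rcases hq0.eq_or_lt with h | h
    · rw [← h]; simp
    · have h3 : qf b ξ x * (qf b ξ x * ν) ≤ qf b ξ x * ‖x - ξ‖ ^ 2 := by
        calc qf b ξ x * (qf b ξ x * ν) = ν * qf b ξ x ^ 2 := by ring
          _ ≤ ν * (‖x - ξ‖ ^ 2 * ∑ i, qg b ξ x i ^ 2) := by gcongr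
          _ = ‖x - ξ‖ ^ 2 * (ν * ∑ i, qg b ξ x i ^ 2) := by ring
          _ ≤ ‖x - ξ‖ ^ 2 * qf b ξ x := by gcongr
          _ = _ := by ring
      exact le_of_mul_le_mul_left h3 h
  · have hcol : ∀ i j, ν * b i j ^ 2 ≤ b j j := by
      intro i j
      have h1 := hiii 0 (EuclideanSpace.single j 1)
      have h2 : ∀ k, qg b 0 (EuclideanSpace.single j 1) k = b k j := by
        intro k; simp [qg]
      rw [hqz] at h1
      simp only [h2] at h1
      have h3 : ∑ i, ((EuclideanSpace.single j (1:ℝ) : E n) i - (0 : E n) i) * b i j = b j j := by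
        simp
      rw [h3] at h1
      refine le_trans ?_ h1
      have := Finset.single_le_sum (f := fun k => b k j ^ 2) (fun k _ => sq_nonneg _) (Finset.mem_univ i)
      exact mul_le_mul_of_nonneg_left this hν0.le
    intro i j
    have h1 := hcol j j
    have h0 : 0 ≤ b j j := le_trans (by positivity) h1
    have h2 : b j j ≤ ν⁻¹ := by
      rw [← one_div, le_div_iff₀ hν0]
      by_contra hc
      push Not at hc
      have : 0 < b j j := by
        rcases h0.eq_or_lt with h | h
        · rw [← h] at hc; simp at hc; linarith
        · exact h
      nlinarith
    have h3 := hcol i j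
    have h4 : b i j ^ 2 ≤ (ν⁻¹) ^ 2 := by
      have : b i j ^ 2 = ν⁻¹ * (ν * b i j ^ 2) := by field_simp
      rw [this, sq (ν⁻¹)]
      have h5 : 0 < ν⁻¹ := inv_pos.mpr hν0
      exact mul_le_mul_of_nonneg_left (h3.trans h2) h5.le
    exact abs_le_of_sq_le_sq h4 (inv_pos.mpr hν0).le
  · intro ξ x
    have hSb' : ∀ i j, |S i j| ≤ ν⁻¹ := by
      intro i j
      have h1 := hbd i j
      have h2 := hbd j i
      simp only [hS, Matrix.of_apply]
      rw [abs_le] at *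
      constructor <;> linarith [h1.1, h1.2, h2.1, h2.2]
    have h1 : ∀ i, (x i - ξ i) ^ 2 ≤ (ν⁻¹) ^ 2 * (n * ∑ k, qg b ξ x k ^ 2) := by
      intro i
      have h2 : |x i - ξ i| ≤ ν⁻¹ * ∑ k, |qg b ξ x k| := by
        rw [← hSz ξ x i, Finset.mul_sum]
        refine (Finset.abs_sum_le_sum_abs _ _).trans (Finset.sum_le_sum fun j _ => ?_)
        rw [abs_mul]
        exact mul_le_mul_of_nonneg_right (hSb' i j) (abs_nonneg _)
      rw [← sq_abs]
      calc |x i - ξ i| ^ 2 ≤ (ν⁻¹ * ∑ k, |qg b ξ x k|) ^ 2 := by gcongr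
        _ = (ν⁻¹) ^ 2 * (∑ k, |qg b ξ x k|) ^ 2 := by ring
        _ ≤ _ := by gcongr; exact sq_sum_le_card _
    rw [hnorm]
    calc ∑ i, (x i - ξ i) ^ 2 ≤ ∑ i : Fin n, (ν⁻¹) ^ 2 * (n * ∑ k, qg b ξ x k ^ 2) :=
          Finset.sum_le_sum fun i _ => h1 i
      _ = n ^ 2 / ν ^ 3 * (ν * ∑ k, qg b ξ x k ^ 2) := by
          simp; field_simp
      _ ≤ _ := by
          gcongr
          exact hiii ξ x


lemma abs_form_le {n : ℕ} (M : Fin n → Fin n → ℝ) (z : Fin n → ℝ) (D : ℝ)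
    (hM : ∀ i j, |M i j| ≤ D) : |∑ i, ∑ j, M i j * z i * z j| ≤ D * (∑ i, |z i|) ^ 2 := by
  refine (Finset.abs_sum_le_sum_abs _ _).trans ?_
  rw [sq, Finset.sum_mul, Finset.mul_sum]
  refine Finset.sum_le_sum fun i _ => (Finset.abs_sum_le_sum_abs _ _).trans ?_
  rw [Finset.mul_sum, Finset.mul_sum]
  refine Finset.sum_le_sum fun j _ => ?_
  rw [abs_mul, abs_mul, mul_assoc]
  exact mul_le_mul_of_nonneg_right (hM i j) (by positivity)

lemma exp_log_sqrt {n : ℕ} {t : ℝ} (ht : 0 < t) :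
    Real.exp (-((n:ℝ) / 2) * Real.log t) = 1 / √t ^ n := by
  have h1 : Real.log (√t) = Real.log t / 2 := Real.log_sqrt ht.le
  have h2 : √t ^ n = Real.exp (n * Real.log (√t)) := by
    rw [mul_comm, Real.exp_mul, Real.exp_log (Real.sqrt_pos.mpr ht), Real.rpow_natCast]
  rw [h2, h1, one_div, ← Real.exp_neg]
  congr 1; ring

lemma kG_continuousAt {n : ℕ} (A B : ℝ) (b : Fin n → Fin n → ℝ) (ξ : E n) (τ : ℝ) (X : E n × ℝ)
    (h : τ < X.2) : ContinuousAt (kG A B b ξ τ) X := by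
  have h0 : X.2 - τ ≠ 0 := by linarith
  have hq : Continuous (qf b ξ) := (qf_contDiff b ξ 0).continuous
  have h4 : (4 * (X.2 - τ)) ≠ 0 := by positivity
  unfold kG
  have hq' : ContinuousAt (fun Y : E n × ℝ => qf b ξ Y.1) X := (hq.comp continuous_fst).continuousAt
  have ht' : ContinuousAt (fun Y : E n × ℝ => Y.2 - τ) X := by fun_prop
  exact (((continuousAt_const.mul (ht'.log h0)).add (continuousAt_const.mul ht'.sqrt)).sub
    ((hq'.sub (continuousAt_const.mul ((hq'.add ht').sqrt.pow 3))).div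
      (continuousAt_const.mul ht') h4)).rexp

lemma kG_lower {n : ℕ} {A B ν : ℝ} {b : Fin n → Fin n → ℝ} (hν0 : 0 < ν) (hA : 0 ≤ A) (hB : 0 ≤ B)
    (ξ x : E n) (t1 ε : ℝ) (hε : 0 < ε) (h4 : qf b ξ x ≤ ε / ν) :
    Real.exp (-(1 / (4 * ν))) / √ε ^ n ≤ kG A B b ξ (t1 - ε) (x, t1) := by
  unfold kG
  have e1 : t1 - (t1 - ε) = ε := by ring
  simp only [e1]
  rw [sub_eq_add_neg, add_assoc, Real.exp_add, exp_log_sqrt hε, div_mul_eq_mul_div, one_mul]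
  gcongr
  have h1 : 0 ≤ A * √ε := by positivity
  have h2 : (qf b ξ x - B * √(qf b ξ x + ε) ^ 3) / (4 * ε) ≤ 1 / (4 * ν) := by
    rw [div_le_div_iff₀ (by positivity) (by positivity)]
    have h3 : 0 ≤ B * √(qf b ξ x + ε) ^ 3 := by positivity
    have h5 : qf b ξ x * ν ≤ ε := (le_div_iff₀ hν0).mp h4
    nlinarith
  linarith

set_option maxHeartbeats 1000000 in
lemma kernel {n : ℕ} {ν : ℝ} (hν : ν ∈ Ioc (0:ℝ) 1) (Λ : ℝ) (hΛ : 0 ≤ Λ) :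
    ∃ A B r0 c0 C0 : ℝ, 0 < r0 ∧ r0 ≤ 1 ∧ 0 < c0 ∧ 0 < C0 ∧
    ∀ (a : E n × ℝ → Fin n → Fin n → ℝ) (ξ : E n) (t1 : ℝ),
      (∀ z : Fin n → ℝ, ν * ∑ i, z i ^ 2 ≤ ∑ i, ∑ j, a (ξ, t1) i j * z i * z j) →
      (∀ i j, |a (ξ, t1) i j| ≤ ν⁻¹) →
      ∃ b : Fin n → Fin n → ℝ, ∀ ε : ℝ, 0 < ε →
        (∀ x t', ‖x - ξ‖ ≤ r0 → t1 ≤ t' → t' - t1 + ε ≤ r0 ^ 2 →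
          (∀ i j, |a (x, t') i j - a (ξ, t1) i j| ≤ Λ * (‖x - ξ‖ + (t' - t1))) →
          (∀ z : Fin n → ℝ, 0 ≤ ∑ i, ∑ j, a (x, t') i j * z i * z j) →
          Reg (kG A B b ξ (t1 - ε)) (x, t') ∧ LVal a (kG A B b ξ (t1 - ε)) (x, t') ≤ 0 ∧
          kG A B b ξ (t1 - ε) (x, t') ≤ C0 / √(t' - t1 + ε) ^ n) ∧
        (∀ x, ‖x - ξ‖ ^ 2 ≤ ε → c0 / √ε ^ n ≤ kG A B b ξ (t1 - ε) (x, t1)) := by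
  have hν0 : 0 < ν := hν.1
  obtain ⟨c, hc⟩ : ∃ c : ℝ, c = √((n:ℝ) ^ 2 / ν ^ 3) := ⟨_, rfl⟩
  have hc0 : 0 ≤ c := by rw [hc]; exact Real.sqrt_nonneg _
  obtain ⟨C, hC⟩ : ∃ C : ℝ, C = 4 * Λ * n * (c + 1) / ν + 2 * n ^ 2 * Λ * (c + 1) / ν := ⟨_, rfl⟩
  have hC0 : 0 ≤ C := by rw [hC]; positivity
  obtain ⟨B, hB⟩ : ∃ B : ℝ, B = C + 4 := ⟨_, rfl⟩
  have hB0 : 0 < B := by linarith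
  obtain ⟨σ0, hσ0⟩ : ∃ σ0 : ℝ, σ0 = 1 / (9 * B) := ⟨_, rfl⟩
  have hσ0pos : 0 < σ0 := by rw [hσ0]; positivity
  have hσ01 : σ0 ≤ 1 := by
    rw [hσ0, div_le_one (by positivity)]; linarith
  have hBσ0 : B * σ0 = 1 / 9 := by rw [hσ0]; field_simp
  obtain ⟨A, hA⟩ : ∃ A : ℝ, A = 2 * (B / 4 + 3 * B * (4 + C) / 16 + (3 * n * B + C) / 4 + 1) ^ 2 := ⟨_, rfl⟩
  have hA0 : 0 ≤ A := by rw [hA]; positivity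
  obtain ⟨r0, hr0⟩ : ∃ r0 : ℝ, r0 = σ0 * ν / 2 := ⟨_, rfl⟩
  have hr0pos : 0 < r0 := by rw [hr0]; positivity
  have hr01 : r0 ≤ 1 := by rw [hr0]; nlinarith [hν.2]
  have hr0σ : r0 ^ 2 / ν + r0 ^ 2 ≤ σ0 ^ 2 := by
    have h1 : r0 ^ 2 / ν = σ0 ^ 2 * ν / 4 := by rw [hr0]; field_simp; ring
    have h2 : r0 ^ 2 = σ0 ^ 2 * ν ^ 2 / 4 := by rw [hr0]; ring
    have h3 : 0 < σ0 ^ 2 := by positivity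
    rw [h1, h2]
    have h4 : ν ^ 2 ≤ 1 := by nlinarith [hν.2]
    nlinarith [hν.2]
  refine ⟨A, B, r0, Real.exp (-(1 / (4 * ν))), Real.exp (A + 1), hr0pos, hr01, Real.exp_pos _,
    Real.exp_pos _, ?_⟩
  intro a ξ t1 hell hbd
  obtain ⟨b, hbsym, hi, hii, hiii, hiv, hv, hvi⟩ := frozen hν (a (ξ, t1)) hell hbd
  have hqnn : ∀ x, 0 ≤ qf b ξ x := fun x =>
    le_trans (mul_nonneg hν0.le (Finset.sum_nonneg fun i _ => sq_nonneg _)) (hiii ξ x)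
  refine ⟨b, fun ε hε => ⟨?_, ?_⟩⟩
  · intro x t' hx ht htr hLip hpsd
    have hτ : t1 - ε < t' := by linarith
    obtain ⟨hreg, hL⟩ := kG_LVal a A B b hbsym ξ x (t1 - ε) t' hτ (hqnn x)
    set q := qf b ξ x with hq
    have hq0 : 0 ≤ q := hqnn x
    have ht_eq : t' - (t1 - ε) = t' - t1 + ε := by ring
    rw [ht_eq] at hL
    set t := t' - t1 + ε with htdef
    have ht0 : 0 < t := by linarith
    set s := √t with hs
    have hs0 : 0 < s := Real.sqrt_pos.mpr ht0
    have hs2 : s ^ 2 = t := Real.sq_sqrt ht0.le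
    set σ := √(q + t) with hσ
    have hσ2 : σ ^ 2 = q + t := Real.sq_sqrt (by linarith)
    have hsσ : s ≤ σ := Real.sqrt_le_sqrt (by linarith)
    have hσpos : 0 < σ := hs0.trans_le hsσ
    have hσσ0 : σ ≤ σ0 := by
      apply Real.sqrt_le_iff.mpr ⟨hσ0pos.le, ?_⟩
      have h1 := hiv ξ x
      have h2 : ‖x - ξ‖ ^ 2 / ν ≤ r0 ^ 2 / ν := by gcongr
      linarith
    have hσ1 : σ ≤ 1 := hσσ0.trans hσ01
    have hBσ : B * σ ≤ 1 / 9 := by rw [← hBσ0]; gcongr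
    have hd : ‖x - ξ‖ + (t' - t1) ≤ (c + 1) * σ := by
      have h1 : ‖x - ξ‖ ≤ c * σ := by
        apply abs_le_of_sq_le_sq' _ (by positivity) |>.2
        have h2 : (c * σ) ^ 2 = n ^ 2 / ν ^ 3 * σ ^ 2 := by
          rw [mul_pow, hc, Real.sq_sqrt (by positivity)]
        rw [h2]
        refine (hvi ξ x).trans ?_
        gcongr
        rw [hσ2]; linarith
      have h3 : t' - t1 ≤ σ := by
        have : σ ^ 2 ≤ σ := by nlinarith
        linarith
      linarith
    have hD : ∀ i j, |a (x, t') i j - a (ξ, t1) i j| ≤ Λ * ((c + 1) * σ) := fun i j =>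
      (hLip i j).trans (by gcongr)
    have hsumz : ∑ i, qg b ξ x i ^ 2 ≤ q / ν := by
      rw [le_div_iff₀ hν0, mul_comm]; exact hiii ξ x
    have hP : 4 * ∑ i, ∑ j, a (x, t') i j * qg b ξ x i * qg b ξ x j ≤ 4 * q + C * σ * q := by
      have h1 := abs_form_le (fun i j => a (x, t') i j - a (ξ, t1) i j) (qg b ξ x) _ hD
      have h2 : ∑ i, ∑ j, (a (x, t') i j - a (ξ, t1) i j) * qg b ξ x i * qg b ξ x j
          = ∑ i, ∑ j, a (x, t') i j * qg b ξ x i * qg b ξ x j - q := by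
        rw [hq, ← hi ξ x]
        simp only [sub_mul, Finset.sum_sub_distrib]
      rw [h2] at h1
      have h3 := (abs_le.mp h1).2
      have h4 : Λ * ((c + 1) * σ) * (∑ i, |qg b ξ x i|) ^ 2 ≤ Λ * ((c + 1) * σ) * (n * (q / ν)) := by
        gcongr
        exact (sq_sum_le_card _).trans (by gcongr)
      have h5 : 4 * (Λ * ((c + 1) * σ) * (n * (q / ν))) = 4 * Λ * n * (c + 1) / ν * σ * q := by
        field_simp
      have h6 : 4 * Λ * n * (c + 1) / ν * σ * q ≤ C * σ * q := by
        gcongr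
        rw [hC]
        have : 0 ≤ 2 * (n:ℝ) ^ 2 * Λ * (c + 1) / ν := by positivity
        linarith
      linarith
    have hW : 2 * (n:ℝ) - C * σ ≤ 2 * ∑ i, ∑ j, a (x, t') i j * b i j := by
      have h1 : |∑ i, ∑ j, (a (x, t') i j - a (ξ, t1) i j) * b i j|
          ≤ ∑ i : Fin n, ∑ j : Fin n, Λ * ((c + 1) * σ) * ν⁻¹ := by
        refine (Finset.abs_sum_le_sum_abs _ _).trans (Finset.sum_le_sum fun i _ =>
          (Finset.abs_sum_le_sum_abs _ _).trans (Finset.sum_le_sum fun j _ => ?_))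
        rw [abs_mul]
        exact mul_le_mul (hD i j) (hv i j) (abs_nonneg _) (by positivity)
      have h2 : ∑ i, ∑ j, (a (x, t') i j - a (ξ, t1) i j) * b i j
          = ∑ i, ∑ j, a (x, t') i j * b i j - n := by
        rw [← hii]
        simp only [sub_mul, Finset.sum_sub_distrib]
      rw [h2] at h1
      have h3 := (abs_le.mp h1).1
      simp only [Finset.sum_const, Finset.card_univ, Fintype.card_fin, nsmul_eq_mul] at h3
      have h5 : 2 * (n * (n * (Λ * ((c + 1) * σ) * ν⁻¹))) = 2 * n ^ 2 * Λ * (c + 1) / ν * σ := by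
        field_simp
      have h6 : 2 * n ^ 2 * Λ * (c + 1) / ν * σ ≤ C * σ := by
        gcongr
        rw [hC]
        have : 0 ≤ 4 * Λ * n * (c + 1) / ν := by positivity
        linarith
      linarith
    refine ⟨hreg, ?_, ?_⟩
    · rw [hL]
      apply mul_nonpos_of_nonneg_of_nonpos (Real.exp_pos _).le
      have := ker_scalar (N := n) (A := A) (B := B) (C := C) (s := s) (σ := σ) (q := q)
        (Nat.cast_nonneg n) hs0 hsσ (by rw [hσ2, hs2]; ring) hσ1 hC0 hB0 hBσ (by linarith) hP
        (mul_nonneg (by norm_num) (hpsd _)) hW hA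
      rw [hs2] at this
      exact this
    · unfold kG
      simp only [ht_eq, ← hq, ← htdef, ← hs, ← hσ]
      rw [sub_eq_add_neg, add_assoc, Real.exp_add, exp_log_sqrt ht0, ← hs, div_mul_eq_mul_div, one_mul]
      refine div_le_div_of_nonneg_right (Real.exp_le_exp.mpr ?_) (by positivity)
      have h1 : A * s ≤ A := by
        have : s ≤ 1 := hsσ.trans hσ1
        nlinarith
      have h2 : -((q - B * σ ^ 3) / (4 * t)) ≤ 1 := by
        rw [← neg_div, div_le_one (by positivity)]
        have : B * σ ^ 3 = B * σ * (q + t) := by rw [← hσ2]; ring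
        have : B * σ * (q + t) ≤ 1 / 9 * (q + t) := by gcongr
        linarith
      exact add_le_add h1 h2
  · intro x hx
    exact kG_lower hν0 hA0 hB0.le ξ x t1 ε hε ((hiv ξ x).trans (by gcongr))


lemma exists_net {n : ℕ} {D : Set (E n)} (hD : IsCompact D) {r : ℝ} (hr : 0 < r) :
    ∃ I : Finset (E n), (∀ i ∈ I, i ∈ D) ∧ (∀ i ∈ I, ∀ j ∈ I, i ≠ j → r < dist i j) ∧
      ∀ x ∈ D, ∃ i ∈ I, dist x i ≤ r := by
  set R : NNReal := ⟨r, hr.le⟩ with hR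
  have hfin : packingNumber R D ≠ ⊤ := by
    obtain ⟨t, htD, htf, hcov⟩ := hD.finite_cover_balls (e := r / 2) (by positivity)
    have h1 : packingNumber (2 * (R / 2)) D ≤ externalCoveringNumber (R / 2) D :=
      packingNumber_two_mul_le_externalCoveringNumber _ _
    have h2 : (2 * (R / 2)) = R := by ring
    rw [h2] at h1
    have h3 : IsCover (R / 2) D t := by
      intro x hx
      have := hcov hx
      simp only [mem_iUnion, mem_ball] at this
      obtain ⟨i, hi, hxi⟩ := this
      refine ⟨i, hi, ?_⟩
      show edist x i ≤ _
      rw [edist_dist]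
      have h4 : ((R / 2 : NNReal) : ENNReal) = ENNReal.ofReal (r / 2) := by
        rw [ENNReal.ofReal, ENNReal.coe_inj]
        ext
        rw [Real.coe_toNNReal _ (by positivity)]
        rfl
      rw [h4]
      exact ENNReal.ofReal_le_ofReal hxi.le
    have h5 := h1.trans h3.externalCoveringNumber_le_encard
    exact ne_top_of_le_ne_top htf.encard_lt_top.ne h5
  have hencard := encard_maximalSeparatedSet hfin
  have hfinite : (maximalSeparatedSet R D).Finite := by
    rw [← Set.encard_ne_top_iff, hencard]; exact hfin
  have hRr : (R : ENNReal) = ENNReal.ofReal r := by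
    rw [ENNReal.ofReal, ENNReal.coe_inj]
    ext
    rw [Real.coe_toNNReal _ hr.le]; rfl
  refine ⟨hfinite.toFinset, ?_, ?_, ?_⟩
  · intro i hi
    exact maximalSeparatedSet_subset (hfinite.mem_toFinset.mp hi)
  · intro i hi j hj hij
    have h1 := isSeparated_maximalSeparatedSet (hfinite.mem_toFinset.mp hi) (hfinite.mem_toFinset.mp hj) hij
    rw [hRr, edist_dist] at h1
    exact (ENNReal.ofReal_lt_ofReal_iff_of_nonneg hr.le).mp h1
  · intro x hx
    obtain ⟨i, hi, hxi⟩ := isCover_maximalSeparatedSet hfin hx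
    refine ⟨i, hfinite.mem_toFinset.mpr hi, ?_⟩
    have h1 : edist x i ≤ R := hxi
    rw [hRr, edist_dist] at h1
    exact (ENNReal.ofReal_le_ofReal_iff hr.le).mp h1

lemma riemann_bound {n : ℕ} {y : E n} {R r η : ℝ} (hr : 0 < r) (hrR : r ≤ R) (hη : 0 ≤ η) {g : E n → ℝ}
    (hg : ContinuousOn g (closedBall y R)) (hg0 : ∀ x, 0 ≤ g x) (I : Finset (E n))
    (hI : ∀ i ∈ I, i ∈ closedBall y (R / 2))
    (hsep : ∀ i ∈ I, ∀ j ∈ I, i ≠ j → r < dist i j)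
    (hmod : ∀ x ∈ closedBall y R, ∀ x' ∈ closedBall y R, dist x x' ≤ r → g x' ≤ g x + η) :
    ∑ i ∈ I, g i * ((r / 2) ^ n * volume.real (ball (0 : E n) 1))
      ≤ (∫ x in closedBall y R, g x) + η * volume.real (closedBall y R) := by
  have hvol : ∀ i : E n, volume.real (ball i (r / 2)) = (r / 2) ^ n * volume.real (ball (0 : E n) 1) := by
    intro i
    have := Measure.addHaar_ball_of_pos (volume : Measure (E n)) i (r := r / 2) (by positivity)
    rw [Measure.real, this, ENNReal.toReal_mul, ENNReal.toReal_ofReal (by positivity)]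
    simp [Measure.real]
  have hsub : ∀ i ∈ I, ball i (r / 2) ⊆ closedBall y R := by
    intro i hi x hx
    have h1 := mem_closedBall.mp (hI i hi)
    have h2 := mem_ball.mp hx
    rw [mem_closedBall]
    linarith [dist_triangle x i y]
  have hIntg : IntegrableOn (fun x => g x + η) (closedBall y R) :=
    (hg.add continuousOn_const).integrableOn_compact (isCompact_closedBall y R)
  have hgint : IntegrableOn g (closedBall y R) := hg.integrableOn_compact (isCompact_closedBall y R)
  calc ∑ i ∈ I, g i * ((r / 2) ^ n * volume.real (ball (0 : E n) 1))
      ≤ ∑ i ∈ I, ∫ x in ball i (r / 2), (g x + η) := by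
        refine Finset.sum_le_sum fun i hi => ?_
        rw [← hvol i, mul_comm, ← smul_eq_mul, ← setIntegral_const]
        refine setIntegral_mono_on ?_ (hIntg.mono_set (hsub i hi)) measurableSet_ball ?_
        · exact integrableOn_const measure_ball_lt_top.ne
        · intro x hx
          have hi' : i ∈ closedBall y R := by
            have := mem_closedBall.mp (hI i hi)
            rw [mem_closedBall]; linarith
          refine hmod x (hsub i hi hx) i hi' ?_
          have := mem_ball.mp hx
          linarith
    _ = ∫ x in ⋃ i ∈ I, ball i (r / 2), (g x + η) := by
        rw [integral_biUnion_finset]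
        · intro i _; exact measurableSet_ball
        · intro i hi j hj hij
          refine ball_disjoint_ball ?_
          have := hsep i hi j hj hij
          linarith
        · intro i hi; exact hIntg.mono_set (hsub i hi)
    _ ≤ ∫ x in closedBall y R, (g x + η) := by
        refine setIntegral_mono_set hIntg ?_ ?_
        · exact Eventually.of_forall fun x => add_nonneg (hg0 x) hη
        · exact (iUnion₂_subset hsub).eventuallyLE
    _ = _ := by
        rw [integral_add hgint (integrableOn_const measure_closedBall_lt_top.ne), setIntegral_const,
          smul_eq_mul, mul_comm]


lemma qf_one {n : ℕ} (y x : E n) : qf (fun i j => if i = j then (1:ℝ) else 0) y x = ‖x - y‖ ^ 2 := by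
  rw [EuclideanSpace.norm_sq_eq]
  simp [qf, sq]

/-- quadratic barrier -/
def quad {n : ℕ} (P C1 : ℝ) (y : E n) (t1 : ℝ) (Y : E n × ℝ) : ℝ :=
  P * (‖Y.1 - y‖ ^ 2 + C1 * (Y.2 - t1))

lemma quad_cont {n : ℕ} (P C1 : ℝ) (y : E n) (t1 : ℝ) : Continuous (quad P C1 y t1) := by
  unfold quad; fun_prop

lemma quad_LVal {n : ℕ} (a : E n × ℝ → Fin n → Fin n → ℝ) (P C1 : ℝ) (y x : E n) (t1 t : ℝ) :
    Reg (quad P C1 y t1) (x, t) ∧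
    LVal a (quad P C1 y t1) (x, t) = P * (2 * ∑ i, a (x, t) i i - C1) := by
  have ht : HasDerivAt (fun τ => quad P C1 y t1 (x, τ)) (P * C1) t := by
    have h1 := ((((hasDerivAt_id t).sub_const t1).const_mul C1).const_add (‖x - y‖ ^ 2)).const_mul P
    simpa [quad] using h1
  have key := comp_qf a (fun i j => if i = j then (1:ℝ) else 0)
    (fun i j => by simp [eq_comm]) y x t (quad P C1 y t1)
    (fun w => P * (w + C1 * (t - t1))) (fun _ => P) 0 (P * C1)
    (fun z => by simp [quad, qf_one]) (by fun_prop)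
    (Eventually.of_forall fun w => by
      simpa using ((hasDerivAt_id w).add_const (C1 * (t - t1))).const_mul P)
    (hasDerivAt_const _ _) ht
  refine ⟨key.1, ?_⟩
  rw [key.2]
  simp
  ring

lemma trace_le {n : ℕ} {ν : ℝ} (A0 : Fin n → Fin n → ℝ) (hbd : ∀ i j, |A0 i j| ≤ ν⁻¹) :
    ∑ i, A0 i i ≤ n / ν := by
  calc ∑ i, A0 i i ≤ ∑ _i : Fin n, ν⁻¹ := Finset.sum_le_sum fun i _ => (abs_le.mp (hbd i i)).2
    _ = n / ν := by simp [div_eq_mul_inv]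

lemma psd_of_ell {n : ℕ} {ν : ℝ} (hν : 0 < ν) {A0 : Fin n → Fin n → ℝ}
    (hell : ∀ z : Fin n → ℝ, ν * ∑ i, z i ^ 2 ≤ ∑ i, ∑ j, A0 i j * z i * z j) (z : Fin n → ℝ) :
    0 ≤ ∑ i, ∑ j, A0 i j * z i * z j :=
  le_trans (mul_nonneg hν.le (Finset.sum_nonneg fun i _ => sq_nonneg _)) (hell z)

/-- the data for the key lemma -/
structure KLData {n : ℕ} (ν Λ : ℝ) (a : E n × ℝ → Fin n → Fin n → ℝ) (U : E n × ℝ → ℝ)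
    (x0 : E n) (ρ τ s M : ℝ) : Prop where
  hell : ∀ x ∈ closedBall x0 ρ, ∀ t ∈ Icc τ s, ∀ z : Fin n → ℝ,
    ν * ∑ i, z i ^ 2 ≤ ∑ i, ∑ j, a (x, t) i j * z i * z j
  hbd : ∀ x ∈ closedBall x0 ρ, ∀ t ∈ Icc τ s, ∀ i j, |a (x, t) i j| ≤ ν⁻¹
  hLip : ∀ x ∈ closedBall x0 ρ, ∀ t ∈ Icc τ s, ∀ x' ∈ closedBall x0 ρ, ∀ t' ∈ Icc τ s, ∀ i j,
    |a (x, t) i j - a (x', t') i j| ≤ Λ * (‖x - x'‖ + |t - t'|)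
  hreg : ∀ x ∈ closedBall x0 ρ, ∀ t ∈ Ioc τ s, Reg U (x, t)
  hL : ∀ x ∈ closedBall x0 ρ, ∀ t ∈ Ioc τ s, LVal a U (x, t) = 0
  hrc : ∀ x ∈ closedBall x0 ρ, ∀ t ∈ Ioc τ s,
    Tendsto U (nhdsWithin (x, t) {Y : E n × ℝ | t ≤ Y.2}) (nhds (U (x, t)))
  hM : ∀ x ∈ closedBall x0 ρ, ∀ t ∈ Icc τ s, |U (x, t)| ≤ M

set_option maxHeartbeats 1000000 in
lemma KL_step {n : ℕ} {ν : ℝ} (hν : ν ∈ Ioc (0:ℝ) 1) (Λ : ℝ) (hΛ : 0 ≤ Λ) :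
    ∃ r0 Kc : ℝ, 0 < r0 ∧ 0 < Kc ∧ ∀ (a : E n × ℝ → Fin n → Fin n → ℝ) (U : E n × ℝ → ℝ)
      (x0 : E n) (ρ τ s M c : ℝ), KLData ν Λ a U x0 ρ τ s M → 0 < ρ → ρ ≤ r0 →
      s - τ ≤ r0 ^ 2 / 2 → 0 < M → |c| ≤ M →
      ∀ y ∈ closedBall x0 (ρ / 2), ∀ t1 ∈ Ioo τ s,
        c - 2 * M / (ρ / 4) ^ 2 * (2 * n / ν + 1) * (s - t1)
          - Kc / √(s - t1) ^ n * (∫ x in closedBall y (ρ / 2), max (c - U (x, t1)) 0) ≤ U (y, s) := by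
  obtain ⟨A, B, r0, c0, C0, hr0, hr01, hc0, hC0, hker⟩ := kernel (n := n) hν Λ hΛ
  have hν0 := hν.1
  set w0 : ℝ := volume.real (ball (0 : E n) 1) with hw0
  have hw0pos : 0 < w0 := by
    rw [hw0, Measure.real]
    exact ENNReal.toReal_pos (measure_ball_pos _ _ one_pos).ne' measure_ball_lt_top.ne
  set Kc : ℝ := C0 * 2 ^ n / (c0 * w0) with hKc
  have hKcpos : 0 < Kc := by positivity
  refine ⟨r0, Kc, hr0, hKcpos, ?_⟩
  intro a U x0 ρ τ s M c hd hρ hρr hsτ hM hcM y hy t1 ht1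
  obtain ⟨hell, hbd, hLip, hreg, hL, hrc, hMb⟩ := hd
  set P0 : ℝ := 2 * M / (ρ / 4) ^ 2 with hP0
  have hP0pos : 0 < P0 := by positivity
  set C1 : ℝ := 2 * n / ν + 1 with hC1
  have hC1pos : 0 < C1 := by positivity
  set g : E n → ℝ := fun x => max (c - U (x, t1)) 0 with hg
  have hball : ∀ x ∈ closedBall y (ρ / 2), x ∈ closedBall x0 ρ := by
    intro x hx
    rw [mem_closedBall] at *
    linarith [dist_triangle x y x0]
  have hball4 : ∀ x ∈ closedBall y (ρ / 4), x ∈ closedBall y (ρ / 2) := by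
    intro x hx
    rw [mem_closedBall] at *
    linarith
  have ht1' : t1 ∈ Ioc τ s := ⟨ht1.1, ht1.2.le⟩
  have hgc : ContinuousOn g (closedBall y (ρ / 2)) := by
    intro x hx
    have h1 := (hreg x (hball x hx) t1 ht1').1.continuousAt
    have h2 : ContinuousAt g x := (continuousAt_const.sub h1).max continuousAt_const
    exact h2.continuousWithinAt
  have hg0 : ∀ x, 0 ≤ g x := fun x => le_max_right _ _
  set Int : ℝ := ∫ x in closedBall y (ρ / 2), g x with hInt
  set S : ℝ := Kc / √(s - t1) ^ n with hS
  have hst : 0 < s - t1 := by linarith [ht1.2]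
  have hSpos : 0 < S := by positivity
  set vol : ℝ := volume.real (closedBall y (ρ / 2)) with hvol
  have hvol0 : 0 ≤ vol := measureReal_nonneg
  have main : ∀ η > 0, c - P0 * C1 * (s - t1) - S * Int ≤ U (y, s) + η * (1 + S * vol) := by
    intro η hη
    have huc := (isCompact_closedBall y (ρ / 2)).uniformContinuousOn_of_continuous hgc
    rw [Metric.uniformContinuousOn_iff] at huc
    obtain ⟨δ, hδ, hmod⟩ := huc η hη
    set r : ℝ := min (δ / 2) (min (ρ / 4) (r0 / 2)) with hr
    have hrpos : 0 < r := by positivity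
    have hrδ : r ≤ δ / 2 := min_le_left _ _
    have hrρ : r ≤ ρ / 4 := (min_le_right _ _).trans (min_le_left _ _)
    have hrr0 : r ≤ r0 / 2 := (min_le_right _ _).trans (min_le_right _ _)
    have hmod' : ∀ x ∈ closedBall y (ρ / 2), ∀ x' ∈ closedBall y (ρ / 2), dist x x' ≤ r →
        g x' ≤ g x + η := by
      intro x hx x' hx' hd
      have := hmod x hx x' hx' (by linarith)
      rw [Real.dist_eq] at this
      linarith [(abs_lt.mp this).1]
    obtain ⟨I, hID, hIsep, hIcov⟩ := exists_net (isCompact_closedBall y (ρ / 4)) hrpos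
    have hriem := riemann_bound (R := ρ / 2) hrpos (by linarith) hη.le hgc hg0 I
      (fun i hi => by have := hID i hi; rw [mem_closedBall] at *; linarith) hIsep hmod'
    have hexb : ∀ ξ : E n, ∃ b : Fin n → Fin n → ℝ, ξ ∈ closedBall y (ρ / 4) →
        (∀ x t', ‖x - ξ‖ ≤ r0 → t1 ≤ t' → t' - t1 + r ^ 2 ≤ r0 ^ 2 →
          (∀ i j, |a (x, t') i j - a (ξ, t1) i j| ≤ Λ * (‖x - ξ‖ + (t' - t1))) →
          (∀ z : Fin n → ℝ, 0 ≤ ∑ i, ∑ j, a (x, t') i j * z i * z j) →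
          Reg (kG A B b ξ (t1 - r ^ 2)) (x, t') ∧ LVal a (kG A B b ξ (t1 - r ^ 2)) (x, t') ≤ 0 ∧
          kG A B b ξ (t1 - r ^ 2) (x, t') ≤ C0 / √(t' - t1 + r ^ 2) ^ n) ∧
        (∀ x, ‖x - ξ‖ ^ 2 ≤ r ^ 2 → c0 / √(r ^ 2) ^ n ≤ kG A B b ξ (t1 - r ^ 2) (x, t1)) := by
      intro ξ
      by_cases hξ : ξ ∈ closedBall y (ρ / 4)
      · have hξ' := hball ξ (hball4 ξ hξ)
        obtain ⟨b, hb⟩ := hker a ξ t1 (hell ξ hξ' t1 ⟨ht1.1.le, ht1.2.le⟩)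
          (hbd ξ hξ' t1 ⟨ht1.1.le, ht1.2.le⟩)
        exact ⟨b, fun _ => hb (r ^ 2) (by positivity)⟩
      · exact ⟨fun _ _ => 0, fun h => absurd h hξ⟩
    choose b hb using hexb
    set G : E n → E n × ℝ → ℝ := fun ξ => kG A B (b ξ) ξ (t1 - r ^ 2) with hG
    have hGpos : ∀ ξ Y, 0 ≤ G ξ Y := fun ξ Y => (Real.exp_pos _).le
    have hGc : ∀ ξ (x : E n) t', t1 ≤ t' → ContinuousAt (G ξ) (x, t') := fun ξ x t' h =>
      kG_continuousAt _ _ _ _ _ _ (by show t1 - r ^ 2 < t'; have : 0 < r ^ 2 := by positivity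
                                      linarith)
    have hGprop : ∀ ξ ∈ I, ∀ x ∈ closedBall y (ρ / 4), ∀ t' ∈ Icc t1 s,
        Reg (G ξ) (x, t') ∧ LVal a (G ξ) (x, t') ≤ 0 ∧ G ξ (x, t') ≤ C0 / √(t' - t1 + r ^ 2) ^ n := by
      intro ξ hξ x hx t' ht'
      have hξ' := hID ξ hξ
      have htt : t' ∈ Icc τ s := ⟨ht1.1.le.trans ht'.1, ht'.2⟩
      refine (hb ξ hξ').1 x t' ?_ ht'.1 ?_ ?_ ?_
      · rw [← dist_eq_norm]
        rw [mem_closedBall] at hx hξ'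
        have := dist_triangle_right x ξ y
        linarith
      · have : r ^ 2 ≤ (r0 / 2) ^ 2 := by gcongr
        have h1 := ht'.2
        have h2 := ht1.1
        nlinarith
      · intro i j
        have := hLip x (hball x (hball4 x hx)) t' htt ξ (hball ξ (hball4 ξ hξ')) t1
          ⟨ht1.1.le, ht1.2.le⟩ i j
        rwa [abs_of_nonneg (by linarith [ht'.1] : 0 ≤ t' - t1)] at this
      · exact psd_of_ell hν0 (hell x (hball x (hball4 x hx)) t' htt)
    have hsqrt : √(r ^ 2) = r := Real.sqrt_sq hrpos.le
    set wt : E n → ℝ := fun ξ => g ξ * (r ^ n / c0) with hwt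
    have hwt0 : ∀ ξ, 0 ≤ wt ξ := fun ξ => mul_nonneg (hg0 ξ) (by positivity)
    set K : E n × ℝ → ℝ := fun Y => ∑ ξ ∈ I, wt ξ * G ξ Y with hK
    have hK0 : ∀ Y, 0 ≤ K Y := fun Y => Finset.sum_nonneg fun ξ _ => mul_nonneg (hwt0 ξ) (hGpos ξ Y)
    have hKc' : ∀ (x : E n) t', t1 ≤ t' → ContinuousAt K (x, t') := by
      intro x t' h
      exact tendsto_finsetSum _ fun ξ _ => (continuousAt_const.mul (hGc ξ x t' h))
    set f : E n × ℝ → ℝ := fun Y => (U Y + K Y) + (quad P0 C1 y t1 Y + (η - c)) with hf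
    have hfin := CL (f := f) (y := y) (R := ρ / 4) (t1 := t1) (s := s) ?_ ?_ ?_ ?_ ?_
    · have h0 := hfin y (mem_closedBall_self (by positivity)) s ⟨ht1.2.le, le_rfl⟩
      have hKs : K (y, s) ≤ S * (Int + η * vol) := by
        have h1 : K (y, s) ≤ ∑ ξ ∈ I, wt ξ * (C0 / √(s - t1) ^ n) := by
          refine Finset.sum_le_sum fun ξ hξ => ?_
          refine mul_le_mul_of_nonneg_left ?_ (hwt0 ξ)
          refine (hGprop ξ hξ y (mem_closedBall_self (by positivity)) s ⟨ht1.2.le, le_rfl⟩).2.2.trans ?_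
          gcongr
          have : 0 ≤ r ^ 2 := by positivity
          linarith
        have h2 : ∑ ξ ∈ I, wt ξ * (C0 / √(s - t1) ^ n)
            = S * ∑ ξ ∈ I, g ξ * ((r / 2) ^ n * w0) := by
          rw [Finset.mul_sum]
          refine Finset.sum_congr rfl fun ξ _ => ?_
          simp only [hwt, hS, hKc]
          rw [div_pow]
          field_simp
        rw [h2] at h1
        exact h1.trans (mul_le_mul_of_nonneg_left hriem hSpos.le)
      have h3 : quad P0 C1 y t1 (y, s) = P0 * C1 * (s - t1) := by simp [quad]; ring
      have h4 : f (y, s) = (U (y, s) + K (y, s)) + (quad P0 C1 y t1 (y, s) + (η - c)) := rfl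
      rw [h4, h3] at h0
      nlinarith
    · intro t ht x hx
      have htt : t ∈ Ioc τ s := ⟨ht1.1.trans_le ht.1, ht.2⟩
      have h1 := (hreg x (hball x (hball4 x hx)) t htt).1.continuousAt
      have hmk : ContinuousAt (fun x' : E n => (x', t)) x := by fun_prop
      have h2 : ContinuousAt (fun x' => K (x', t)) x :=
        ContinuousAt.comp (f := fun x' : E n => (x', t)) (hKc' x t ht.1) hmk
      have h3 : ContinuousAt (fun x' => quad P0 C1 y t1 (x', t)) x :=
        ContinuousAt.comp (f := fun x' : E n => (x', t)) (quad_cont P0 C1 y t1).continuousAt hmk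
      exact ((h1.add h2).add (h3.add continuousAt_const)).continuousWithinAt
    · intro x hx t ht c' hc'
      have htt : t ∈ Ioc τ s := ⟨ht1.1.trans_le ht.1, ht.2⟩
      have h1 := hrc x (hball x (hball4 x hx)) t htt
      have h2 : Tendsto f (nhdsWithin (x, t) {Y : E n × ℝ | t ≤ Y.2}) (nhds (f (x, t))) :=
        (h1.add ((hKc' x t ht.1).tendsto.mono_left nhdsWithin_le_nhds)).add
          (((quad_cont P0 C1 y t1).tendsto _ |>.mono_left nhdsWithin_le_nhds).add tendsto_const_nhds)
      exact h2.eventually (lt_mem_nhds hc')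
    · intro x hx
      obtain ⟨ξ, hξ, hxξ⟩ := hIcov x hx
      have h1 : g ξ ≤ K (x, t1) := by
        have h2 : wt ξ * G ξ (x, t1) ≤ K (x, t1) :=
          Finset.single_le_sum (f := fun ξ => wt ξ * G ξ (x, t1))
            (fun ξ _ => mul_nonneg (hwt0 ξ) (hGpos ξ _)) hξ
        have h3 := (hb ξ (hID ξ hξ)).2 x (by rw [← dist_eq_norm]; gcongr)
        rw [hsqrt] at h3
        have h4 : wt ξ * (c0 / r ^ n) ≤ wt ξ * G ξ (x, t1) := mul_le_mul_of_nonneg_left h3 (hwt0 ξ)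
        have h5 : wt ξ * (c0 / r ^ n) = g ξ := by
          simp only [hwt]; field_simp
        linarith
      have h6 : g x ≤ g ξ + η :=
        hmod' ξ (hball4 ξ (hID ξ hξ)) x (hball4 x hx) (by rw [dist_comm]; exact hxξ)
      have h7 : c - U (x, t1) ≤ g x := le_max_left _ _
      have h8 : 0 ≤ quad P0 C1 y t1 (x, t1) := by
        simp only [quad, sub_self, mul_zero, add_zero]; positivity
      show 0 ≤ (U (x, t1) + K (x, t1)) + (quad P0 C1 y t1 (x, t1) + (η - c))
      linarith
    · intro x hx t ht
      have hx' : x ∈ closedBall y (ρ / 4) := sphere_subset_closedBall hx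
      have h1 : 2 * M ≤ quad P0 C1 y t1 (x, t) := by
        have h2 : ‖x - y‖ = ρ / 4 := by rw [← dist_eq_norm]; exact hx
        simp only [quad, h2]
        have h3 : P0 * (ρ / 4) ^ 2 = 2 * M := by rw [hP0]; field_simp
        have h4 : 0 ≤ P0 * (C1 * (t - t1)) :=
          mul_nonneg hP0pos.le (mul_nonneg hC1pos.le (by linarith [ht.1]))
        rw [mul_add, h3]; linarith
      have h5 := hMb x (hball x (hball4 x hx')) t ⟨ht1.1.le.trans ht.1, ht.2⟩
      have h6 := hK0 (x, t)
      show 0 ≤ (U (x, t) + K (x, t)) + (quad P0 C1 y t1 (x, t) + (η - c))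
      linarith [(abs_le.mp h5).1, (abs_le.mp hcM).2]
    · intro x hx t ht hmin
      have hx' : x ∈ closedBall y (ρ / 4) := ball_subset_closedBall hx
      have hx'' := hball x (hball4 x hx')
      have htt : t ∈ Ioc τ s := ⟨ht1.1.trans ht.1, ht.2⟩
      have htt' : t ∈ Icc τ s := ⟨htt.1.le, htt.2⟩
      by_contra hcon
      push Not at hcon
      have hKreg : Reg K (x, t) := Reg.sum I fun ξ hξ =>
        (hGprop ξ hξ x hx' t ⟨ht.1.le, ht.2⟩).1.const_mul _
      have hUreg := hreg x hx'' t htt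
      have hq := quad_LVal a P0 C1 y x t1 t
      have hfreg : Reg f (x, t) := (hUreg.add hKreg).add (hq.1.add (Reg.const _ _))
      have hpos := LVal_nonneg_of_min hfreg (psd_of_ell hν0 (hell x hx'' t htt')) hmin ht.1 hcon
      have hLf : LVal a f (x, t) = (LVal a U (x, t) + LVal a K (x, t))
          + (LVal a (quad P0 C1 y t1) (x, t) + 0) := by
        rw [hf, LVal_add a (hUreg.add hKreg) (hq.1.add (Reg.const _ _)), LVal_add a hUreg hKreg,
          LVal_add a hq.1 (Reg.const _ _), LVal_const]
      have hLK : LVal a K (x, t) ≤ 0 := by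
        rw [hK, LVal_sum a I fun ξ hξ => (hGprop ξ hξ x hx' t ⟨ht.1.le, ht.2⟩).1.const_mul _]
        refine Finset.sum_nonpos fun ξ hξ => ?_
        have h1 := hGprop ξ hξ x hx' t ⟨ht.1.le, ht.2⟩
        rw [LVal_const_mul a _ h1.1]
        exact mul_nonpos_of_nonneg_of_nonpos (hwt0 ξ) h1.2.1
      have htr := trace_le _ (hbd x hx'' t htt')
      have hneg : P0 * (2 * ∑ i, a (x, t) i i - C1) < 0 := by
        apply mul_neg_of_pos_of_neg hP0pos
        rw [hC1, mul_div_assoc]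
        linarith
      rw [hLf, hL x hx'' t htt, hq.2] at hpos
      linarith
  by_contra hcon
  push Not at hcon
  set gap := c - P0 * C1 * (s - t1) - S * Int - U (y, s) with hgap
  have hgpos : 0 < gap := by rw [hgap]; linarith
  have h1 : 0 < 1 + S * vol := by positivity
  have := main (gap / 2 / (1 + S * vol)) (by positivity)
  rw [div_mul_cancel₀ _ h1.ne'] at this
  linarith


lemma KL_lim {n : ℕ} {ν : ℝ} (hν : ν ∈ Ioc (0:ℝ) 1) (Λ : ℝ) (hΛ : 0 ≤ Λ) :
    ∃ r0 : ℝ, 0 < r0 ∧ ∀ (a : E n × ℝ → Fin n → Fin n → ℝ) (U : E n × ℝ → ℝ)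
      (x0 : E n) (ρ τ s M c : ℝ), KLData ν Λ a U x0 ρ τ s M → 0 < ρ → ρ ≤ r0 →
      s - τ ≤ r0 ^ 2 / 2 → τ < s → 0 < M → |c| ≤ M →
      (∀ x ∈ closedBall x0 ρ, Tendsto (fun t => U (x, t)) (nhdsWithin τ (Ioi τ)) (nhds (U (x, τ)))) →
      (∀ x ∈ closedBall x0 ρ, c ≤ U (x, τ)) →
      ∀ y ∈ closedBall x0 (ρ / 2),
        c - 2 * M / (ρ / 4) ^ 2 * (2 * n / ν + 1) * (s - τ) ≤ U (y, s) := by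
  obtain ⟨r0, Kc, hr0, hKc, h⟩ := KL_step (n := n) hν Λ hΛ
  refine ⟨r0, hr0, ?_⟩
  intro a U x0 ρ τ s M c hd hρ hρr hsτ hτs hM hcM hlim hc y hy
  have hst := h a U x0 ρ τ s M c hd hρ hρr hsτ hM hcM y hy
  have hball : ∀ x ∈ closedBall y (ρ / 2), x ∈ closedBall x0 ρ := by
    intro x hx
    rw [mem_closedBall] at *
    linarith [dist_triangle x y x0]
  have hev : ∀ᶠ t1 in nhdsWithin τ (Ioi τ), t1 ∈ Ioo τ s := Ioo_mem_nhdsGT hτs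
  have hIntg : Tendsto (fun t1 => ∫ x in closedBall y (ρ / 2), max (c - U (x, t1)) 0)
      (nhdsWithin τ (Ioi τ)) (nhds (∫ x in closedBall y (ρ / 2), (0:ℝ))) := by
    refine tendsto_integral_filter_of_dominated_convergence (fun _ => 2 * M) ?_ ?_ ?_ ?_
    · filter_upwards [hev] with t1 ht1
      refine ContinuousOn.aestronglyMeasurable ?_ measurableSet_closedBall
      intro x hx
      have h1 := (hd.hreg x (hball x hx) t1 ⟨ht1.1, ht1.2.le⟩).1.continuousAt
      have h2 : ContinuousAt (fun x => max (c - U (x, t1)) 0) x :=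
        (continuousAt_const.sub h1).max continuousAt_const
      exact h2.continuousWithinAt
    · filter_upwards [hev] with t1 ht1
      filter_upwards [ae_restrict_mem measurableSet_closedBall] with x hx
      have h5 := abs_le.mp (hd.hM x (hball x hx) t1 ⟨ht1.1.le, ht1.2.le⟩)
      have h6 := abs_le.mp hcM
      rw [Real.norm_eq_abs, abs_of_nonneg (le_max_right _ _)]
      exact max_le (by linarith) (by linarith)
    · exact integrableOn_const measure_closedBall_lt_top.ne
    · filter_upwards [ae_restrict_mem measurableSet_closedBall] with x hx
      have h1 : Tendsto (fun t1 => max (c - U (x, t1)) 0) (nhdsWithin τ (Ioi τ))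
          (nhds (max (c - U (x, τ)) 0)) :=
        (tendsto_const_nhds.sub (hlim x (hball x hx))).max tendsto_const_nhds
      rwa [max_eq_right (by linarith [hc x (hball x hx)])] at h1
  rw [integral_zero] at hIntg
  have hcoef : Tendsto (fun t1 => Kc / √(s - t1) ^ n) (nhdsWithin τ (Ioi τ))
      (nhds (Kc / √(s - τ) ^ n)) := by
    have hp : 0 < √(s - τ) := Real.sqrt_pos.mpr (by linarith)
    have : ContinuousAt (fun t1 => Kc / √(s - t1) ^ n) τ := by
      refine ContinuousAt.div continuousAt_const (by fun_prop) (by positivity)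
    exact this.tendsto.mono_left nhdsWithin_le_nhds
  have hlin : Tendsto (fun t1 => c - 2 * M / (ρ / 4) ^ 2 * (2 * n / ν + 1) * (s - t1))
      (nhdsWithin τ (Ioi τ)) (nhds (c - 2 * M / (ρ / 4) ^ 2 * (2 * n / ν + 1) * (s - τ))) := by
    have : Continuous (fun t1 => c - 2 * M / (ρ / 4) ^ 2 * (2 * n / ν + 1) * (s - t1)) := by fun_prop
    exact this.continuousAt.tendsto.mono_left nhdsWithin_le_nhds
  have hall := hlin.sub (hcoef.mul hIntg)
  rw [mul_zero, sub_zero] at hall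
  refine le_of_tendsto hall ?_
  filter_upwards [hev] with t1 ht1
  exact hst t1 ht1

lemma Reg.neg {n : ℕ} {f : E n × ℝ → ℝ} {X : E n × ℝ} (h : Reg f X) : Reg (fun Y => - f Y) X := by
  have := h.const_mul (-1)
  simpa using this

lemma KLData.neg {n : ℕ} {ν Λ : ℝ} {a : E n × ℝ → Fin n → Fin n → ℝ} {U : E n × ℝ → ℝ}
    {x0 : E n} {ρ τ s M : ℝ} (h : KLData ν Λ a U x0 ρ τ s M) :
    KLData ν Λ a (fun Y => - U Y) x0 ρ τ s M where
  hell := h.hell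
  hbd := h.hbd
  hLip := h.hLip
  hreg x hx t ht := (h.hreg x hx t ht).neg
  hL x hx t ht := by
    have h1 := LVal_const_mul a (-1) (h.hreg x hx t ht)
    rw [h.hL x hx t ht] at h1
    simpa using h1
  hrc x hx t ht := (h.hrc x hx t ht).neg
  hM x hx t ht := by simpa using h.hM x hx t ht

/-- two sided version -/
lemma KL_abs {n : ℕ} {ν : ℝ} (hν : ν ∈ Ioc (0:ℝ) 1) (Λ : ℝ) (hΛ : 0 ≤ Λ) :
    ∃ r0 : ℝ, 0 < r0 ∧ ∀ (a : E n × ℝ → Fin n → Fin n → ℝ) (U : E n × ℝ → ℝ)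
      (x0 : E n) (ρ τ s M c e : ℝ), KLData ν Λ a U x0 ρ τ s M → 0 < ρ → ρ ≤ r0 →
      s - τ ≤ r0 ^ 2 / 2 → τ < s → 0 < M → |c| + e ≤ M → 0 ≤ e →
      (∀ x ∈ closedBall x0 ρ, Tendsto (fun t => U (x, t)) (nhdsWithin τ (Ioi τ)) (nhds (U (x, τ)))) →
      (∀ x ∈ closedBall x0 ρ, |U (x, τ) - c| ≤ e) →
      ∀ y ∈ closedBall x0 (ρ / 2),
        |U (y, s) - c| ≤ e + 2 * M / (ρ / 4) ^ 2 * (2 * n / ν + 1) * (s - τ) := by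
  obtain ⟨r0, hr0, h⟩ := KL_lim (n := n) hν Λ hΛ
  refine ⟨r0, hr0, ?_⟩
  intro a U x0 ρ τ s M c e hd hρ hρr hsτ hτs hM hcM he hlim hc y hy
  have h1 := h a U x0 ρ τ s M (c - e) hd hρ hρr hsτ hτs hM
    (by have := abs_sub c e; rw [abs_of_nonneg he] at this; linarith) hlim
    (fun x hx => by linarith [(abs_le.mp (hc x hx)).1]) y hy
  have h2 := h a (fun Y => - U Y) x0 ρ τ s M (-c - e) hd.neg hρ hρr hsτ hτs hM
    (by have := abs_sub (-c) e; rw [abs_of_nonneg he, abs_neg] at this; linarith)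
    (fun x hx => (hlim x hx).neg)
    (fun x hx => by linarith [(abs_le.mp (hc x hx)).2]) y hy
  rw [abs_le]
  constructor <;> linarith


/-- right joint continuity -/
def RC {n : ℕ} (U : E n × ℝ → ℝ) (X : E n × ℝ) : Prop :=
  Tendsto U (nhdsWithin X {Y : E n × ℝ | X.2 ≤ Y.2}) (nhds (U X))

lemma baire_loc {Z : Type*} [TopologicalSpace Z] [LocallyCompactSpace Z] [T2Space Z]
    {F Q : Set Z} (hF : IsLocallyClosed F) (hne : F.Nonempty)
    (hFQ : F ⊆ Q) (A : ℕ → Set Z) (hcl : ∀ k, closure (A k) ∩ Q ⊆ A k) (hcov : Q ⊆ ⋃ k, A k) :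
    ∃ k, ∃ W : Set Z, IsOpen W ∧ (F ∩ W).Nonempty ∧ F ∩ W ⊆ A k := by
  have : LocallyCompactSpace F := hF.locallyCompactSpace
  have : Nonempty F := hne.to_subtype
  obtain ⟨k, hk⟩ := nonempty_interior_of_iUnion_of_closed
    (f := fun k => ((↑) : F → Z) ⁻¹' closure (A k)) (fun k => isClosed_closure.preimage continuous_subtype_val)
    (by
      rw [eq_univ_iff_forall]
      intro z
      obtain ⟨k, hk⟩ := mem_iUnion.mp (hcov (hFQ z.2))
      exact mem_iUnion.mpr ⟨k, subset_closure hk⟩)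
  obtain ⟨z, hz⟩ := hk
  obtain ⟨V, hV, hVo, hzV⟩ := mem_interior.mp hz
  obtain ⟨W, hWo, rfl⟩ := isOpen_induced_iff.mp hVo
  refine ⟨k, W, hWo, ⟨z, z.2, hzV⟩, ?_⟩
  rintro y ⟨hyF, hyW⟩
  exact hcl k ⟨hV (a := ⟨y, hyF⟩) hyW, hFQ hyF⟩

/-- the sets of uniform difference quotients -/
def AK {n : ℕ} (U : E n × ℝ → ℝ) (k : ℝ) : Set (E n × ℝ) :=
  {X | (∀ s, 0 < s → |s - X.2| < 1 / k → |U (X.1, s) - U X| ≤ k * |s - X.2|) ∧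
    ∀ p, ‖p - X.1‖ < 1 / k → |U (p, X.2) - U X| ≤ k * ‖p - X.1‖}

lemma AK_closed {n : ℕ} {U : E n × ℝ → ℝ} {k : ℝ} (hk : 0 < k)
    (hx : ∀ (x : E n) t, 0 < t → ContinuousAt (fun x' => U (x', t)) x)
    (ht : ∀ (x : E n) t, 0 < t → ContinuousAt (fun t' => U (x, t')) t) :
    closure (AK U k) ∩ Cyl (univ : Set (E n)) ⊆ AK U k := by
  rintro ⟨x, t⟩ ⟨hcl, hQ⟩
  have htpos : 0 < t := hQ.2
  have : NeBot (nhdsWithin (x, t) (AK U k)) := mem_closure_iff_nhdsWithin_neBot.mp hcl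
  obtain ⟨l, hl⟩ : ∃ l, l = nhdsWithin (x, t) (AK U k) := ⟨_, rfl⟩
  have : NeBot l := hl ▸ this
  have hA : ∀ᶠ Y in l, Y ∈ AK U k := hl ▸ self_mem_nhdsWithin
  have hle : l ≤ nhds (x, t) := hl ▸ nhdsWithin_le_nhds
  have h1 : Tendsto (fun Y : E n × ℝ => Y.1) l (nhds x) := (continuous_fst.tendsto (x, t)).mono_left hle
  have h2 : Tendsto (fun Y : E n × ℝ => Y.2) l (nhds t) := (continuous_snd.tendsto (x, t)).mono_left hle
  have hd : ∀ s : ℝ, Tendsto (fun Y : E n × ℝ => |s - Y.2|) l (nhds |s - t|) := fun s =>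
    (tendsto_const_nhds.sub h2).abs
  have hd0 : Tendsto (fun Y : E n × ℝ => |t - Y.2|) l (nhds 0) := by simpa using hd t
  have hk' : 0 < 1 / k := by positivity
  have hUx : ∀ s, 0 < s → Tendsto (fun Y : E n × ℝ => U (Y.1, s)) l (nhds (U (x, s))) :=
    fun s hs => (hx x s hs).tendsto.comp h1
  have hclose : ∀ᶠ Y in l, |U Y - U (Y.1, t)| ≤ k * |t - Y.2| := by
    filter_upwards [hA, hd0.eventually (gt_mem_nhds hk')] with Y hY h3
    rw [abs_sub_comm]
    exact hY.1 t htpos h3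
  have hUU : Tendsto U l (nhds (U (x, t))) := by
    have h4 : Tendsto (fun Y => U Y - U (Y.1, t)) l (nhds 0) := by
      refine squeeze_zero_norm' hclose ?_
      simpa using hd0.const_mul k
    simpa using h4.add (hUx t htpos)
  refine ⟨?_, ?_⟩
  · intro s hs hst
    refine le_of_tendsto_of_tendsto ((hUx s hs).sub hUU).abs ((hd s).const_mul k) ?_
    filter_upwards [hA, (hd s).eventually (gt_mem_nhds hst)] with Y hY h3
    exact hY.1 s hs h3
  · intro p hp
    have h5 : Tendsto (fun Y : E n × ℝ => ‖p - Y.1‖) l (nhds ‖p - x‖) :=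
      (tendsto_const_nhds.sub h1).norm
    have h6 : Tendsto (fun Y : E n × ℝ => U (p, Y.2)) l (nhds (U (p, t))) :=
      (ht p t htpos).tendsto.comp h2
    refine le_of_tendsto_of_tendsto (h6.sub hUU).abs (h5.const_mul k) ?_
    filter_upwards [hA, h5.eventually (gt_mem_nhds hp)] with Y hY h3
    exact hY.2 p h3

lemma AK_cover {n : ℕ} {U : E n × ℝ → ℝ} {X : E n × ℝ} (h : Reg U X) :
    ∃ m : ℕ, X ∈ AK U (m + 1) := by
  have h1 := (h.1.differentiableAt (by norm_num)).isBigO_sub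
  have h2 := h.2.isBigO_sub
  obtain ⟨c1, hc1⟩ := h1.bound
  obtain ⟨c2, hc2⟩ := h2.bound
  obtain ⟨d1, hd1, H1⟩ := Metric.eventually_nhds_iff.mp hc1
  obtain ⟨d2, hd2, H2⟩ := Metric.eventually_nhds_iff.mp hc2
  obtain ⟨m, hm⟩ := exists_nat_ge (max (max c1 c2) (max (1 / d1) (1 / d2)))
  have hm1 : c1 ≤ m + 1 := by linarith [(le_max_left c1 c2).trans ((le_max_left _ _).trans hm)]
  have hm2 : c2 ≤ m + 1 := by linarith [(le_max_right c1 c2).trans ((le_max_left _ _).trans hm)]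
  have hm3 : 1 / d1 ≤ m + 1 := by
    linarith [(le_max_left (1/d1) (1/d2)).trans ((le_max_right _ _).trans hm)]
  have hm4 : 1 / d2 ≤ m + 1 := by
    linarith [(le_max_right (1/d1) (1/d2)).trans ((le_max_right _ _).trans hm)]
  have hm0 : (0:ℝ) < m + 1 := by positivity
  have hm5 : 1 / ((m:ℝ) + 1) ≤ d1 := by
    rw [div_le_iff₀ hm0]; rw [div_le_iff₀ hd1] at hm3; linarith
  have hm6 : 1 / ((m:ℝ) + 1) ≤ d2 := by
    rw [div_le_iff₀ hm0]; rw [div_le_iff₀ hd2] at hm4; linarith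
  refine ⟨m, ?_, ?_⟩
  · intro s _ hs
    have := H2 (y := s) (by rw [Real.dist_eq]; linarith)
    simp only [Real.norm_eq_abs] at this
    exact this.trans (mul_le_mul_of_nonneg_right hm2 (abs_nonneg _))
  · intro p hp
    have := H1 (y := p) (by rw [dist_eq_norm]; linarith)
    simp only [Real.norm_eq_abs] at this
    exact this.trans (mul_le_mul_of_nonneg_right hm1 (norm_nonneg _))

lemma closure_Q {n : ℕ} : closure (Cyl (univ : Set (E n))) = univ ×ˢ Ici (0:ℝ) := by
  simp [Cyl, CylFrom, closure_prod_eq]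

lemma isOpen_Q {n : ℕ} : IsOpen (Cyl (univ : Set (E n))) := isOpen_univ.prod isOpen_Ioi

lemma mem_Q {n : ℕ} {x : E n} {t : ℝ} : (x, t) ∈ Cyl (univ : Set (E n)) ↔ 0 < t := by
  simp [Cyl, CylFrom]

lemma loc_lip {n : ℕ} {ν : ℝ} {a : E n × ℝ → Fin n → Fin n → ℝ}
    (hco : IsParabolicCoeff ν a (closure (Cyl (univ : Set (E n))))) (X0 : E n × ℝ) (h0 : 0 < X0.2) :
    ∃ Λ : ℝ, 0 ≤ Λ ∧ ∀ᶠ ρ in nhdsWithin (0:ℝ) (Ioi 0), ∀ Y ∈ closedBall X0 ρ, ∀ Y' ∈ closedBall X0 ρ,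
      ∀ i j, |a Y i j - a Y' i j| ≤ Λ * (‖Y.1 - Y'.1‖ + |Y.2 - Y'.2|) := by
  have hnb : closure (Cyl (univ : Set (E n))) ∈ nhds X0 :=
    Filter.mem_of_superset (isOpen_Q.mem_nhds (mem_Q.mpr h0)) subset_closure
  have hex : ∀ i j, ∃ K : NNReal, ∃ t ∈ nhds X0, LipschitzOnWith K (fun X => a X i j) t := by
    intro i j
    have h1 : ContDiffAt ℝ 1 (fun X => a X i j) X0 :=
      ((hco.1 i j).contDiffAt hnb).of_le (by exact_mod_cast le_top)
    exact h1.exists_lipschitzOnWith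
  choose K t ht hK using hex
  have hinter : (⋂ i, ⋂ j, t i j) ∈ nhds X0 := by
    rw [Filter.iInter_mem]; intro i; rw [Filter.iInter_mem]; exact ht i
  obtain ⟨d, hd, hsub⟩ := Metric.nhds_basis_closedBall.mem_iff.mp hinter
  refine ⟨∑ i, ∑ j, (K i j : ℝ), by positivity, ?_⟩
  filter_upwards [Ioc_mem_nhdsGT hd] with ρ hρ Y hY Y' hY' i j
  have hm : ∀ Z ∈ closedBall X0 ρ, Z ∈ t i j := fun Z hZ =>
    mem_iInter.mp (mem_iInter.mp (hsub (closedBall_subset_closedBall hρ.2 hZ)) i) j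
  have h2 := (hK i j).dist_le_mul Y (hm Y hY) Y' (hm Y' hY')
  rw [Real.dist_eq] at h2
  have h3 : (K i j : ℝ) ≤ ∑ i, ∑ j, (K i j : ℝ) :=
    (Finset.single_le_sum (f := fun j => (K i j : ℝ)) (fun _ _ => NNReal.coe_nonneg _)
      (Finset.mem_univ j)).trans
    (Finset.single_le_sum (f := fun i => ∑ j, (K i j : ℝ))
      (fun _ _ => Finset.sum_nonneg fun _ _ => NNReal.coe_nonneg _) (Finset.mem_univ i))
  have h4 : dist Y Y' ≤ ‖Y.1 - Y'.1‖ + |Y.2 - Y'.2| := by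
    rw [Prod.dist_eq, dist_eq_norm, Real.dist_eq]
    exact max_le (by linarith [abs_nonneg (Y.2 - Y'.2)]) (by linarith [norm_nonneg (Y.1 - Y'.1)])
  exact h2.trans (mul_le_mul h3 h4 dist_nonneg (le_trans (NNReal.coe_nonneg _) h3))


lemma RC_point {n : ℕ} {ν : ℝ} (hν : ν ∈ Ioc (0:ℝ) 1) {a : E n × ℝ → Fin n → Fin n → ℝ}
    (hco : IsParabolicCoeff ν a (closure (Cyl (univ : Set (E n))))) {U : E n × ℝ → ℝ}
    (hU : SolvesL a U (Cyl univ)) {M : ℝ} (hM : 0 < M) (hMb : ∀ X ∈ Cyl univ, |U X| ≤ M)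
    {F W : Set (E n × ℝ)} {k : ℝ} (hk : 0 < k) (hW : IsOpen W)
    (hF : F = Cyl univ \ interior {X | RC U X}) (hFW : F ∩ W ⊆ AK U k)
    (x0 : E n) (t0 : ℝ) (hX0 : (x0, t0) ∈ F ∩ W) : RC U (x0, t0) := by
  have ht0 : 0 < t0 := mem_Q.mp (hF ▸ hX0.1).1
  obtain ⟨Λ, hΛ, hlip⟩ := loc_lip hco (x0, t0) ht0
  obtain ⟨r0, hr0, hKL⟩ := KL_abs (n := n) hν Λ hΛ
  have hWev : ∀ᶠ ρ in nhdsWithin (0:ℝ) (Ioi 0), closedBall (x0, t0) ρ ⊆ W := by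
    obtain ⟨d, hd, hsub⟩ := Metric.nhds_basis_closedBall.mem_iff.mp (hW.mem_nhds hX0.2)
    filter_upwards [Ioc_mem_nhdsGT hd] with ρ hρ
    exact (closedBall_subset_closedBall hρ.2).trans hsub
  obtain ⟨ρ1, hρ1, hρ1W, hρ1p⟩ := (hlip.and (hWev.and self_mem_nhdsWithin)).exists
  have hρ1p : 0 < ρ1 := hρ1p
  unfold RC
  rw [Metric.tendsto_nhdsWithin_nhds]
  intro ε hε
  obtain ⟨ρ, hρdef⟩ : ∃ ρ, ρ = min (min ρ1 r0) (min (1 / (4 * k)) (min (ε / (16 * k)) (1 / (12 * k)))) := ⟨_, rfl⟩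
  have hρ : 0 < ρ := by rw [hρdef]; positivity
  have hρa : ρ ≤ ρ1 := hρdef ▸ (min_le_left _ _).trans (min_le_left _ _)
  have hρb : ρ ≤ r0 := hρdef ▸ (min_le_left _ _).trans (min_le_right _ _)
  have hρc : ρ ≤ 1 / (4 * k) := hρdef ▸ (min_le_right _ _).trans (min_le_left _ _)
  have hρd : ρ ≤ ε / (16 * k) :=
    hρdef ▸ (min_le_right _ _).trans ((min_le_right _ _).trans (min_le_left _ _))
  have hρe : ρ ≤ 1 / (12 * k) :=
    hρdef ▸ (min_le_right _ _).trans ((min_le_right _ _).trans (min_le_right _ _))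
  obtain ⟨C, hC⟩ : ∃ C, C = 2 * (M + 1) / (ρ / 4) ^ 2 * (2 * n / ν + 1) := ⟨_, rfl⟩
  have hν0 := hν.1
  have hCpos : 0 < C := by rw [hC]; positivity
  obtain ⟨δ, hδdef⟩ : ∃ δ, δ = min (min ρ1 (r0 ^ 2 / 2))
    (min (1 / (2 * k)) (min (ε / (4 * k)) (min (1 / (2 * k)) (ε / (4 * C))))) := ⟨_, rfl⟩
  have hδ : 0 < δ := by rw [hδdef]; positivity
  have hδa : δ ≤ ρ1 := hδdef ▸ (min_le_left _ _).trans (min_le_left _ _)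
  have hδb : δ ≤ r0 ^ 2 / 2 := hδdef ▸ (min_le_left _ _).trans (min_le_right _ _)
  have hδc : δ ≤ 1 / (2 * k) := hδdef ▸ (min_le_right _ _).trans (min_le_left _ _)
  have hδd : δ ≤ ε / (4 * k) :=
    hδdef ▸ (min_le_right _ _).trans ((min_le_right _ _).trans (min_le_left _ _))
  have hδf : δ ≤ ε / (4 * C) :=
    hδdef ▸ (min_le_right _ _).trans ((min_le_right _ _).trans ((min_le_right _ _).trans (min_le_right _ _)))
  clear hδdef hρdef
  have hk2 : 1 / (2 * k) < 1 / k := one_div_lt_one_div_of_lt hk (by linarith)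
  have hk4 : 2 * (1 / (4 * k)) < 1 / k := by
    have : 2 * (1 / (4 * k)) = 1 / (2 * k) := by field_simp; norm_num
    linarith
  have hkρ : k * ρ ≤ ε / 16 := by
    rw [le_div_iff₀ (by positivity)] at hρd; linarith
  have hkρ' : k * ρ ≤ 1 / 12 := by
    rw [le_div_iff₀ (by positivity)] at hρe; linarith
  have hkδ : k * δ ≤ ε / 4 := by
    rw [le_div_iff₀ (by positivity)] at hδd; linarith
  have hkδ' : k * δ ≤ 1 / 2 := by
    rw [le_div_iff₀ (by positivity)] at hδc; linarith
  have hCδ : C * δ ≤ ε / 4 := by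
    rw [le_div_iff₀ (by positivity)] at hδf; linarith
  obtain ⟨e, he⟩ : ∃ e, e = 3 * (k * ρ) + k * δ := ⟨_, rfl⟩
  have he0 : 0 ≤ e := by rw [he]; positivity
  have he1 : e ≤ 1 := by rw [he]; linarith
  have heε : e + C * δ < ε := by rw [he]; linarith
  have hbox : ∀ x ∈ closedBall x0 ρ, ∀ t ∈ Icc t0 (t0 + δ), (x, t) ∈ closedBall (x0, t0) ρ1 := by
    intro x hx t ht
    rw [mem_closedBall, Prod.dist_eq]
    refine max_le ((mem_closedBall.mp hx).trans hρa) ?_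
    rw [Real.dist_eq, abs_of_nonneg (by linarith [ht.1])]
    linarith [ht.2]
  have hA0 := hFW hX0
  have caseA : ∀ s ∈ Icc t0 (t0 + δ), (∃ p ∈ closedBall x0 ρ, (p, s) ∈ F) →
      ∀ q ∈ closedBall x0 ρ, |U (q, s) - U (x0, t0)| ≤ e := by
    rintro s hs ⟨p, hp, hpF⟩ q hq
    have hps := hFW ⟨hpF, hρ1W (hbox p hp s hs)⟩
    rw [mem_closedBall] at hp hq
    have hqp : ‖q - p‖ ≤ 2 * ρ := by
      rw [← dist_eq_norm]; linarith [dist_triangle_right q p x0]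
    have hxp : ‖x0 - p‖ ≤ ρ := by rw [← dist_eq_norm, dist_comm]; exact hp
    have h1 : |U (q, s) - U (p, s)| ≤ k * ‖q - p‖ := hps.2 q (by linarith)
    have h2 : |U (x0, s) - U (p, s)| ≤ k * ‖x0 - p‖ := hps.2 x0 (by linarith)
    have hst : |s - t0| ≤ δ := by rw [abs_of_nonneg (by linarith [hs.1])]; linarith [hs.2]
    have h3 : |U (x0, s) - U (x0, t0)| ≤ k * |s - t0| :=
      hA0.1 s (by linarith [hs.1]) (show |s - t0| < 1 / k by linarith)
    have h1' := mul_le_mul_of_nonneg_left hqp hk.le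
    have h2' := mul_le_mul_of_nonneg_left hxp hk.le
    have h3' := mul_le_mul_of_nonneg_left hst hk.le
    rw [abs_le] at h1 h2 h3 ⊢
    constructor <;> linarith [h1.1, h1.2, h2.1, h2.2, h3.1, h3.2]
  have hall : ∀ s ∈ Ico t0 (t0 + δ), ∀ y ∈ closedBall x0 (ρ / 2), |U (y, s) - U (x0, t0)| < ε := by
    intro s hs y hy
    have hs' : s ∈ Icc t0 (t0 + δ) := ⟨hs.1, hs.2.le⟩
    have hy' : y ∈ closedBall x0 ρ := closedBall_subset_closedBall (by linarith) hy
    by_cases hA : ∃ p ∈ closedBall x0 ρ, (p, s) ∈ F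
    · have h1 := caseA s hs' hA y hy'
      have h2 : 0 ≤ C * δ := by positivity
      linarith
    · obtain ⟨Kc, hKc⟩ : ∃ Kc, Kc = (closedBall x0 ρ ×ˢ Icc t0 s) ∩ (interior {X | RC U X})ᶜ := ⟨_, rfl⟩
      have hcomp : IsCompact Kc := by
        rw [hKc]
        exact ((isCompact_closedBall x0 ρ).prod isCompact_Icc).inter_right isOpen_interior.isClosed_compl
      have hKF : ∀ x t, (x, t) ∈ Kc ↔ x ∈ closedBall x0 ρ ∧ t ∈ Icc t0 s ∧ (x, t) ∈ F := by
        intro x t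
        rw [hKc, hF]
        constructor
        · rintro ⟨h1, h2⟩
          exact ⟨h1.1, h1.2, mem_Q.mpr (ht0.trans_le h1.2.1), h2⟩
        · rintro ⟨h1, h2, h3⟩
          exact ⟨⟨h1, h2⟩, h3.2⟩
      have hne : Kc.Nonempty := ⟨(x0, t0), (hKF _ _).mpr ⟨mem_closedBall_self hρ.le, ⟨le_rfl, hs.1⟩, hX0.1⟩⟩
      obtain ⟨τ, hτ⟩ := (hcomp.image continuous_snd).exists_isGreatest (hne.image _)
      obtain ⟨⟨⟨p, τ'⟩, hpK, hpτ⟩, hτmax⟩ := hτ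
      obtain rfl : τ' = τ := hpτ
      obtain ⟨hp, hτI, hpF⟩ := (hKF _ _).mp hpK
      have hτs : τ' < s := by
        rcases hτI.2.lt_or_eq with h | h
        · exact h
        · exact absurd ⟨p, hp, h ▸ hpF⟩ hA
      have hnotF : ∀ x ∈ closedBall x0 ρ, ∀ t ∈ Ioc τ' s, RC U (x, t) := by
        intro x hx t ht
        by_contra hcon
        have hK' : (x, t) ∈ Kc := (hKF _ _).mpr ⟨hx, ⟨hτI.1.trans ht.1.le, ht.2⟩, by
          rw [hF]
          exact ⟨mem_Q.mpr (ht0.trans_le (hτI.1.trans ht.1.le)), fun h => hcon (interior_subset h)⟩⟩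
        have := hτmax ⟨(x, t), hK', rfl⟩
        linarith [ht.1]
      have hIcc : ∀ t ∈ Icc τ' s, t ∈ Icc t0 (t0 + δ) := fun t ht =>
        ⟨hτI.1.trans ht.1, ht.2.trans hs.2.le⟩
      have hposI : ∀ t ∈ Icc τ' s, 0 < t := fun t ht => ht0.trans_le (hIcc t ht).1
      have hclQ : ∀ (x : E n) t, t ∈ Icc τ' s → (x, t) ∈ closure (Cyl (univ : Set (E n))) :=
        fun x t ht => subset_closure (mem_Q.mpr (hposI t ht))
      have hdat : KLData ν Λ a U x0 ρ τ' s (M + 1) :=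
        { hell := fun x hx t ht => (hco.2 _ (hclQ x t ht)).1
          hbd := fun x hx t ht => (hco.2 _ (hclQ x t ht)).2
          hLip := fun x hx t ht x' hx' t' ht' i j =>
            hρ1 _ (hbox x hx t (hIcc t ht)) _ (hbox x' hx' t' (hIcc t' ht')) i j
          hreg := fun x hx t ht => hU.1 _ (mem_Q.mpr (hposI t ⟨ht.1.le, ht.2⟩))
          hL := fun x hx t ht => hU.2 _ (mem_Q.mpr (hposI t ⟨ht.1.le, ht.2⟩))
          hrc := fun x hx t ht => hnotF x hx t ht
          hM := fun x hx t ht => by linarith [hMb _ (mem_Q.mpr (hposI t ht) : (x, t) ∈ _)] }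
      have hsδ : s - τ' ≤ δ := by linarith [hs.2, hτI.1]
      have h1 := hKL a U x0 ρ τ' s (M + 1) (U (x0, t0)) e hdat hρ hρb (hsδ.trans hδb) hτs
        (by linarith) (by linarith [hMb _ (mem_Q.mpr ht0 : (x0, t0) ∈ _)]) he0
        (fun x hx => ((hU.1 _ (mem_Q.mpr (hposI τ' ⟨le_rfl, hτs.le⟩) : (x, τ') ∈ _)).2.continuousAt).tendsto.mono_left
          nhdsWithin_le_nhds)
        (caseA τ' (hIcc τ' ⟨le_rfl, hτs.le⟩) ⟨p, hp, hpF⟩) y hy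
      rw [← hC] at h1
      have h2 := mul_le_mul_of_nonneg_left hsδ hCpos.le
      linarith
  refine ⟨min (ρ / 2) δ, by positivity, ?_⟩
  rintro ⟨y, s⟩ hs hd
  rw [Prod.dist_eq, max_lt_iff] at hd
  have hs : t0 ≤ s := hs
  have hd2 : dist s t0 < min (ρ / 2) δ := hd.2
  rw [Real.dist_eq, abs_of_nonneg (by linarith)] at hd2
  rw [Real.dist_eq]
  exact hall s ⟨hs, by linarith [min_le_right (ρ / 2) δ]⟩ y
    (mem_closedBall.mpr (hd.1.le.trans (min_le_left _ _)))

theorem RC_all {n : ℕ} {ν : ℝ} (hν : ν ∈ Ioc (0:ℝ) 1) {a : E n × ℝ → Fin n → Fin n → ℝ}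
    (hco : IsParabolicCoeff ν a (closure (Cyl (univ : Set (E n))))) {U : E n × ℝ → ℝ}
    (hU : SolvesL a U (Cyl univ)) {M : ℝ} (hM : 0 < M) (hMb : ∀ X ∈ Cyl univ, |U X| ≤ M) :
    ∀ X ∈ Cyl univ, RC U X := by
  obtain ⟨F, hF⟩ : ∃ F, F = Cyl univ \ interior {X | RC U X} := ⟨_, rfl⟩
  suffices h : F = ∅ by
    intro X hX
    by_contra hcon
    have : X ∈ F := hF ▸ ⟨hX, fun h => hcon (interior_subset h)⟩
    simp [h] at this
  by_contra hne
  have hne := nonempty_iff_ne_empty.mpr hne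
  have hlc : IsLocallyClosed F := by
    rw [hF, sdiff_eq]
    exact isOpen_Q.isLocallyClosed.inter isOpen_interior.isClosed_compl.isLocallyClosed
  have hFQ : F ⊆ Cyl univ := by rw [hF]; exact sdiff_subset
  obtain ⟨k, W, hW, hWne, hWA⟩ := baire_loc hlc hne hFQ (fun m : ℕ => AK U (m + 1))
    (fun m => AK_closed (by positivity)
      (fun x t ht => (hU.1 _ (mem_Q.mpr ht : (x, t) ∈ _)).1.continuousAt)
      (fun x t ht => (hU.1 _ (mem_Q.mpr ht : (x, t) ∈ _)).2.continuousAt))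
    (fun X hX => mem_iUnion.mpr (AK_cover (hU.1 X hX)))
  have hsub : W ∩ Cyl univ ⊆ {X | RC U X} := by
    rintro ⟨x, t⟩ ⟨hXW, hXQ⟩
    by_cases hXF : (x, t) ∈ F
    · exact RC_point hν hco hU hM hMb (by positivity) hW hF hWA x t ⟨hXF, hXW⟩
    · by_contra hcon
      exact hXF (hF ▸ ⟨hXQ, fun h => hcon (interior_subset h)⟩)
  obtain ⟨X, hXF, hXW⟩ := hWne
  have h1 : X ∈ interior {X | RC U X} :=
    mem_interior.mpr ⟨_, hsub, hW.inter isOpen_Q, hXW, hFQ hXF⟩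
  rw [hF] at hXF
  exact hXF.2 h1


theorem comparison {n : ℕ} {ν : ℝ} (hν : ν ∈ Ioc (0:ℝ) 1) {a : E n × ℝ → Fin n → Fin n → ℝ}
    (hco : IsParabolicCoeff ν a (closure (Cyl (univ : Set (E n))))) {U Ψ : E n × ℝ → ℝ}
    (hU : SolvesL a U (Cyl univ)) {M : ℝ} (hM : 0 < M) (hMb : ∀ X ∈ Cyl univ, |U X| ≤ M)
    (hΨM : ∀ X ∈ Cyl univ, |Ψ X| ≤ M) (hΨc : ∀ X ∈ Cyl univ, ContinuousAt Ψ X)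
    (h0 : ∀ x : E n, Tendsto (fun X => U X - Ψ X) (nhdsWithin (x, 0) (Cyl univ)) (nhds 0))
    (hV : ∀ x t, 0 < t → ∃ V : E n × ℝ → ℝ, Reg V (x, t) ∧ 0 ≤ LVal a V (x, t) ∧
      V (x, t) = Ψ (x, t) ∧ ∀ Y ∈ Cyl (univ : Set (E n)), V Y ≤ Ψ Y) :
    ∀ X ∈ Cyl univ, Ψ X ≤ U X := by
  rintro ⟨xs, ts⟩ hX
  have hts : 0 < ts := mem_Q.mp hX
  have hrc := RC_all hν hco hU hM hMb
  have hν0 := hν.1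
  obtain ⟨C1, hC1⟩ : ∃ C1 : ℝ, C1 = 2 * n / ν + 1 := ⟨_, rfl⟩
  have hC1pos : 0 < C1 := by rw [hC1]; positivity
  have main : ∀ ε > 0, Ψ (xs, ts) - ε * (1 + (‖xs‖ ^ 2 + C1 * ts)) ≤ U (xs, ts) := by
    intro ε hε
    obtain ⟨R, hRx, hR⟩ : ∃ R : ℝ, ‖xs‖ ≤ R ∧ 2 * M ≤ ε * R ^ 2 := by
      refine ⟨max ‖xs‖ (max 1 (2 * M / ε)), le_max_left _ _, ?_⟩
      have h1 : 1 ≤ max ‖xs‖ (max 1 (2 * M / ε)) := (le_max_left _ _).trans (le_max_right _ _)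
      have h2 : 2 * M / ε ≤ max ‖xs‖ (max 1 (2 * M / ε)) := (le_max_right _ _).trans (le_max_right _ _)
      generalize max ‖xs‖ (max 1 (2 * M / ε)) = R at *
      rw [div_le_iff₀ hε] at h2
      nlinarith [mul_nonneg hε.le (mul_nonneg (by linarith : (0:ℝ) ≤ R) (by linarith : (0:ℝ) ≤ R - 1))]
    have hR0 : 0 ≤ R := (norm_nonneg _).trans hRx
    have key : ∀ᶠ t in nhds (0:ℝ), ∀ x ∈ closedBall (0 : E n) R, 0 < t → -ε < U (x, t) - Ψ (x, t) := by
      refine (isCompact_closedBall (0 : E n) R).eventually_forall_of_forall_eventually ?_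
      intro x hx
      have h1 := (h0 x).eventually (lt_mem_nhds (by linarith : -ε < 0))
      rw [eventually_nhdsWithin_iff] at h1
      have h2 : Tendsto (fun z : ℝ × E n => (z.2, z.1)) (nhds ((0:ℝ), x)) (nhds (x, (0:ℝ))) :=
        (continuous_snd.prodMk continuous_fst).tendsto _
      filter_upwards [h2.eventually h1] with z hz hz0
      exact hz (mem_Q.mpr hz0)
    obtain ⟨d, hd, hdk⟩ := Metric.eventually_nhds_iff.mp key
    obtain ⟨t1, ht1, ht1d, ht1s⟩ : ∃ t1, 0 < t1 ∧ t1 < d ∧ t1 < ts := by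
      refine ⟨min d ts / 2, by positivity, ?_, ?_⟩
      · linarith [min_le_left d ts, lt_min hd hts]
      · linarith [min_le_right d ts, lt_min hd hts]
    have hbot0 := hdk (y := t1) (by rw [Real.dist_eq, sub_zero, abs_of_pos ht1]; exact ht1d)
    have hCL := CL (f := fun Y => (U Y + (-1) * Ψ Y) + (quad ε C1 (0 : E n) 0 Y + ε))
      (y := (0 : E n)) (R := R) (t1 := t1) (s := ts) ?_ ?_ ?_ ?_ ?_
    · have h1 := hCL xs (by simpa using hRx) ts ⟨ht1s.le, le_rfl⟩
      simp only [quad, sub_zero] at h1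
      linarith
    · intro t ht x hx
      have hQ : (x, t) ∈ Cyl (univ : Set (E n)) := mem_Q.mpr (ht1.trans_le ht.1)
      have hmk : ContinuousAt (fun x' : E n => (x', t)) x := by fun_prop
      have h1 := (hU.1 _ hQ).1.continuousAt
      have h2 : ContinuousAt (fun x' => Ψ (x', t)) x :=
        ContinuousAt.comp (f := fun x' : E n => (x', t)) (hΨc _ hQ) hmk
      have h3 : ContinuousAt (fun x' => quad ε C1 0 0 (x', t)) x :=
        ContinuousAt.comp (f := fun x' : E n => (x', t)) (quad_cont ε C1 0 0).continuousAt hmk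
      exact ((h1.add (continuousAt_const.mul h2)).add (h3.add continuousAt_const)).continuousWithinAt
    · intro x hx t ht c' hc'
      have hQ : (x, t) ∈ Cyl (univ : Set (E n)) := mem_Q.mpr (ht1.trans_le ht.1)
      have h1 : Tendsto U (nhdsWithin (x, t) {Y : E n × ℝ | t ≤ Y.2}) (nhds (U (x, t))) := hrc _ hQ
      have h2 := (h1.add (((hΨc _ hQ).tendsto.mono_left nhdsWithin_le_nhds).const_mul (-1))).add
          (((quad_cont ε C1 0 0).tendsto _ |>.mono_left nhdsWithin_le_nhds).add_const ε)
      exact h2.eventually (lt_mem_nhds hc')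
    · intro x hx
      have h1 := hbot0 x hx ht1
      have h2 : 0 ≤ quad ε C1 0 0 (x, t1) := by simp only [quad, sub_zero]; positivity
      show 0 ≤ (U (x, t1) + (-1) * Ψ (x, t1)) + (quad ε C1 (0 : E n) 0 (x, t1) + ε)
      linarith
    · intro x hx t ht
      have htp := ht1.trans_le ht.1
      have hQ : (x, t) ∈ Cyl (univ : Set (E n)) := mem_Q.mpr htp
      have hxR : ‖x‖ = R := by simpa using hx
      have h2 : 2 * M ≤ quad ε C1 0 0 (x, t) := by
        simp only [quad, sub_zero, hxR]
        have : 0 ≤ ε * (C1 * t) := by positivity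
        rw [mul_add]; linarith
      have h3 := abs_le.mp (hMb _ hQ)
      have h4 := abs_le.mp (hΨM _ hQ)
      show 0 ≤ (U (x, t) + (-1) * Ψ (x, t)) + (quad ε C1 (0 : E n) 0 (x, t) + ε)
      linarith [h3.1, h4.2]
    · intro x hx t ht hmin
      have htp := ht1.trans ht.1
      have hQ : (x, t) ∈ Cyl (univ : Set (E n)) := mem_Q.mpr htp
      have hclQ := subset_closure hQ
      by_contra hcon
      push Not at hcon
      obtain ⟨V, hVr, hVL, hVe, hVle⟩ := hV x t htp
      have hUr := hU.1 _ hQ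
      have hq := quad_LVal a ε C1 0 x 0 t
      have hUr : Reg U (x, t) := hUr
      have hfr := (hUr.add (hVr.const_mul (-1))).add (hq.1.add (Reg.const (x, t) ε))
      have hpos := LVal_nonneg_of_min hfr (psd_of_ell hν0 (hco.2 _ hclQ).1)
        (by
          filter_upwards [hmin] with x' hx'
          have h1 := hVle (x', t) (mem_Q.mpr htp)

          rw [hVe]
          linarith) ht.1
        (by
          intro t' ht'
          have h1 := hVle (x, t') (mem_Q.mpr (ht1.trans_le ht'.1))
          have h2 := hcon t' ht'

          rw [hVe]
          linarith)
      rw [LVal_add a (hUr.add (hVr.const_mul (-1))) (hq.1.add (Reg.const (x, t) ε)),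
        LVal_add a hUr (hVr.const_mul (-1)), LVal_const_mul a _ hVr,
        LVal_add a hq.1 (Reg.const (x, t) ε), LVal_const, hU.2 _ hQ, hq.2] at hpos
      have htr := trace_le _ (hco.2 _ hclQ).2
      have hneg : ε * (2 * ∑ i, a (x, t) i i - C1) < 0 := by
        apply mul_neg_of_pos_of_neg hε
        rw [hC1, mul_div_assoc]
        linarith
      linarith
  by_contra hcon
  push Not at hcon
  obtain ⟨D, hD⟩ : ∃ D, D = 1 + (‖xs‖ ^ 2 + C1 * ts) := ⟨_, rfl⟩
  have hDpos : 0 < D := by rw [hD]; positivity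
  have := main ((Ψ (xs, ts) - U (xs, ts)) / 2 / D) (by
    have : 0 < Ψ (xs, ts) - U (xs, ts) := by linarith
    positivity)
  rw [← hD, div_mul_cancel₀ _ hDpos.ne'] at this
  linarith


/-- Gaussian barrier -/
def bar {n : ℕ} (c1 c2 k γ s : ℝ) (Y : E n × ℝ) : ℝ :=
  Real.exp (-γ * Real.log (Y.2 + s)) * (c1 * Real.exp (-k * (‖Y.1‖ ^ 2 / (Y.2 + s))) + c2)

lemma bar_cont {n : ℕ} (c1 c2 k γ s : ℝ) (Y : E n × ℝ) (h : 0 < Y.2 + s) :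
    ContinuousAt (bar (n := n) c1 c2 k γ s) Y := by
  unfold bar
  have hT : ContinuousAt (fun Y : E n × ℝ => Y.2 + s) Y := by fun_prop
  refine ContinuousAt.mul ?_ ?_
  · exact (continuousAt_const.mul (hT.log h.ne')).rexp
  · refine ContinuousAt.add (continuousAt_const.mul (ContinuousAt.rexp ?_)) continuousAt_const
    exact continuousAt_const.mul (ContinuousAt.div (by fun_prop) hT h.ne')

lemma bar_abs {n : ℕ} (c1 c2 k γ s : ℝ) (hk : 0 ≤ k) (hγ : 0 ≤ γ) (hs : 0 < s) (Y : E n × ℝ)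
    (h : 0 ≤ Y.2) :
    |bar (n := n) c1 c2 k γ s Y| ≤ Real.exp (-γ * Real.log s) * (|c1| + |c2|) := by
  unfold bar
  rw [abs_mul, Real.abs_exp]
  refine mul_le_mul ?_ ?_ (abs_nonneg _) (Real.exp_pos _).le
  · apply Real.exp_le_exp.mpr
    have := Real.log_le_log hs (by linarith : s ≤ Y.2 + s)
    have := mul_le_mul_of_nonneg_left this hγ
    linarith
  · refine (abs_add_le _ _).trans ?_
    rw [abs_mul, Real.abs_exp]
    have h1 : Real.exp (-k * (‖Y.1‖ ^ 2 / (Y.2 + s))) ≤ 1 := by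
      rw [Real.exp_le_one_iff]
      have : 0 ≤ k * (‖Y.1‖ ^ 2 / (Y.2 + s)) := by positivity
      linarith
    have := mul_le_mul_of_nonneg_left h1 (abs_nonneg c1)
    linarith

lemma bar_LVal {n : ℕ} (a : E n × ℝ → Fin n → Fin n → ℝ) (c1 c2 k γ s : ℝ) (x : E n) (t : ℝ)
    (h : 0 < t + s) :
    Reg (bar c1 c2 k γ s) (x, t) ∧ LVal a (bar c1 c2 k γ s) (x, t) =
      Real.exp (-γ * Real.log (t + s)) / (t + s) *
        (c1 * Real.exp (-k * (‖x‖ ^ 2 / (t + s))) *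
          (4 * k ^ 2 * ((∑ i, ∑ j, a (x, t) i j * x i * x j) / (t + s)) - 2 * k * ∑ i, a (x, t) i i
            - k * (‖x‖ ^ 2 / (t + s)) + γ) + c2 * γ) := by
  obtain ⟨T, hT⟩ : ∃ T, T = t + s := ⟨_, rfl⟩
  obtain ⟨G, hG⟩ : ∃ G, G = Real.exp (-γ * Real.log T) := ⟨_, rfl⟩
  obtain ⟨p, hp⟩ : ∃ p, p = ‖x‖ ^ 2 := ⟨_, rfl⟩
  have hT0 : T ≠ 0 := by rw [hT]; exact h.ne'
  have hTd : HasDerivAt (fun τ : ℝ => τ + s) 1 t := (hasDerivAt_id t).add_const s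
  have hGd : HasDerivAt (fun τ : ℝ => Real.exp (-γ * Real.log (τ + s))) (G * (-γ * (1 / T))) t := by
    have := ((hTd.log h.ne').const_mul (-γ)).exp
    rwa [← hT, ← hG] at this
  have hed : HasDerivAt (fun τ : ℝ => Real.exp (-k * (p / (τ + s))))
      (Real.exp (-k * (p / T)) * (-k * ((0 * T - p * 1) / T ^ 2))) t := by
    have h0 : HasDerivAt (fun τ : ℝ => p / (τ + s)) ((0 * (t + s) - p * 1) / (t + s) ^ 2) t :=
      (hasDerivAt_const t p).div hTd h.ne'
    have := (h0.const_mul (-k)).exp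
    rwa [← hT] at this
  have ht : HasDerivAt (fun τ => bar c1 c2 k γ s (x, τ)) (G * (-γ * (1 / T)) * (c1 * Real.exp (-k * (p / T)) + c2)
      + G * (c1 * (Real.exp (-k * (p / T)) * (-k * ((0 * T - p * 1) / T ^ 2))))) t := by
    have := hGd.mul ((hed.const_mul c1).add_const c2)
    rw [← hT, ← hG] at this
    rw [hp] at this ⊢
    exact this
  have hexp : ∀ w : ℝ, HasDerivAt (fun w => Real.exp (-k * (w / T))) (Real.exp (-k * (w / T)) * (-k * (1 / T))) w :=
    fun w => (((hasDerivAt_id w).div_const T).const_mul (-k)).exp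
  have key := comp_qf a (fun i j => if i = j then (1:ℝ) else 0)
    (fun i j => by simp [eq_comm]) 0 x t (bar c1 c2 k γ s)
    (fun w => G * (c1 * Real.exp (-k * (w / T)) + c2))
    (fun w => G * (c1 * (Real.exp (-k * (w / T)) * (-k * (1 / T)))))
    (G * (c1 * (Real.exp (-k * (p / T)) * (-k * (1 / T)) * (-k * (1 / T)))))
    _
    (fun z => by simp only [bar, qf_one, ← hT, ← hG, sub_zero]) (by fun_prop)
    (Eventually.of_forall fun w => (((hexp w).const_mul c1).add_const c2).const_mul G)
    (by
      rw [qf_one, sub_zero, ← hp]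
      exact (((hexp p).mul_const _).const_mul c1).const_mul G)
    ht
  refine ⟨key.1, ?_⟩
  rw [key.2, qf_one, sub_zero, ← hp, ← hT, ← hG]
  have hqg : ∀ i, qg (fun i j => if i = j then (1:ℝ) else 0) (0 : E n) x i = x i := by
    intro i; simp [qg]
  have htr : ∑ i, ∑ j, a (x, t) i j * (if i = j then (1:ℝ) else 0) = ∑ i, a (x, t) i i := by simp
  simp only [hqg]
  rw [htr]
  generalize (∑ i, ∑ j, a (x, t) i j * x i * x j) = q
  generalize (∑ i, a (x, t) i i) = tr
  generalize Real.exp (-k * (p / T)) = e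
  field_simp
  ring

lemma form_bounds {n : ℕ} {ν : ℝ} (hν : ν ∈ Ioc (0:ℝ) 1) {A0 : Fin n → Fin n → ℝ}
    (hell : ∀ z : Fin n → ℝ, ν * ∑ i, z i ^ 2 ≤ ∑ i, ∑ j, A0 i j * z i * z j)
    (hbd : ∀ i j, |A0 i j| ≤ ν⁻¹) (x : E n) :
    ν * ‖x‖ ^ 2 ≤ ∑ i, ∑ j, A0 i j * x i * x j ∧ ∑ i, ∑ j, A0 i j * x i * x j ≤ n / ν * ‖x‖ ^ 2 ∧
    0 ≤ ∑ i, A0 i i ∧ ∑ i, A0 i i ≤ n / ν := by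
  have hν0 := hν.1
  refine ⟨?_, ?_, ?_, trace_le A0 hbd⟩
  · rw [EuclideanSpace.norm_sq_eq]; simpa using hell x
  · have h1 := (abs_le.mp (abs_form_le A0 x _ hbd)).2
    have h2 : (∑ i, |x i|) ^ 2 ≤ n * ‖x‖ ^ 2 := by
      have := sq_sum_le_card_mul_sum_sq (s := Finset.univ) (f := fun i => |x i|)
      rw [EuclideanSpace.norm_sq_eq]
      simpa using this
    have h3 := mul_le_mul_of_nonneg_left h2 (inv_nonneg.mpr hν0.le)
    rw [div_eq_mul_inv]
    linarith
  · refine Finset.sum_nonneg fun i _ => ?_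
    have h1 := hell (fun j => if j = i then 1 else 0)
    simp at h1
    linarith


lemma barrier_data (n : ℕ) (hn : 1 ≤ n) (ν : ℝ) (hν : ν ∈ Ioc (0 : ℝ) 1) (K : ℝ) :
    ∃ α κ γ R δ c : ℝ, 0 < α ∧ 0 < κ ∧ 0 < γ ∧ 0 < R ∧ 0 < δ ∧ 0 < c ∧
      (∀ z q tr, 0 ≤ z → z ≤ R → ν * z ≤ q → tr ≤ n / ν →
        0 ≤ Real.exp (-α * z) * (4 * α ^ 2 * q - 2 * α * tr - α * z + γ) - δ * γ) ∧
      (∀ z q tr, R / 2 ≤ z → q ≤ n / ν * z → 0 ≤ tr → 4 * κ ^ 2 * q - 2 * κ * tr - κ * z + γ ≤ 0) ∧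
      (∀ z, z ≤ R / 2 → -c * Real.exp (-κ * z) ≤ Real.exp (-α * z) - δ ∧ 0 ≤ Real.exp (-α * z) - δ) ∧
      (∀ z, R ≤ z → Real.exp (-α * z) - δ < -c * Real.exp (-κ * z)) ∧
      K ^ 2 ≤ R / 2 := by
  have hν0 := hν.1
  have hν1 := hν.2
  have hn' : (1:ℝ) ≤ n := by exact_mod_cast hn
  have hn0 : (0:ℝ) < n := by linarith
  obtain ⟨α, hα⟩ : ∃ α, α = 1 / ν := ⟨_, rfl⟩
  obtain ⟨κ, hκ⟩ : ∃ κ, κ = ν / (8 * n) := ⟨_, rfl⟩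
  obtain ⟨γ, hγ⟩ : ∃ γ, γ = 4 * n / ν ^ 2 := ⟨_, rfl⟩
  have hα0 : 0 < α := by rw [hα]; positivity
  have hκ0 : 0 < κ := by rw [hκ]; positivity
  have hγ0 : 0 < γ := by rw [hγ]; positivity
  obtain ⟨R, hR⟩ : ∃ R, R = 2 * K ^ 2 + 4 * γ / κ + 2 * γ + 6 + 4 / κ := ⟨_, rfl⟩
  have p1 : 0 < 4 * γ / κ := by positivity
  have p2 : 0 < 4 / κ := by positivity
  have p3 : 0 ≤ 2 * K ^ 2 := by positivity
  have hα1 : 1 ≤ α := by rw [hα, le_div_iff₀ hν0]; linarith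
  have hαν : α * ν = 1 := by rw [hα]; field_simp
  have hR0 : 0 < R := by rw [hR]; linarith
  have hRK : K ^ 2 ≤ R / 2 := by rw [hR]; linarith
  have hRκ : 2 ≤ κ * (R / 2) := by
    have h1 : 4 / κ ≤ R := by rw [hR]; linarith
    rw [div_le_iff₀ hκ0] at h1; linarith
  have hRγκ : 2 * γ ≤ κ * (R / 2) := by
    have h1 : 4 * γ / κ ≤ R := by rw [hR]; linarith
    rw [div_le_iff₀ hκ0] at h1; linarith
  have hRγ : 2 * γ ≤ R := by rw [hR]; linarith
  have hR6 : 6 ≤ R := by rw [hR]; linarith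
  have hαR : R ≤ α * R := by nlinarith
  clear hR p1 p2 p3
  have e1 : ∀ y : ℝ, 3 ≤ y → Real.exp (-y) ≤ 1 / 4 := by
    intro y hy
    rw [Real.exp_neg, inv_eq_one_div]
    exact one_div_le_one_div_of_le (by norm_num) (by linarith [Real.add_one_le_exp y])
  have e2 : ∀ y : ℝ, 2 ≤ y → Real.exp (-y) ≤ 1 / 3 := by
    intro y hy
    rw [Real.exp_neg, inv_eq_one_div]
    exact one_div_le_one_div_of_le (by norm_num) (by linarith [Real.add_one_le_exp y])
  have hδ : 0 < 2 * Real.exp (-α * R) := by positivity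
  refine ⟨α, κ, γ, R, 2 * Real.exp (-α * R), 2 * Real.exp (-α * R) * Real.exp (κ * (R / 2)),
    hα0, hκ0, hγ0, hR0, hδ, by positivity, ?_, ?_, ?_, ?_, hRK⟩
  · intro z q tr hz hzR hq htr
    have h1 : 4 * (α * z) ≤ 4 * α ^ 2 * q := by
      have := mul_le_mul_of_nonneg_left hq (by positivity : 0 ≤ 4 * α ^ 2)
      have h2 : 4 * α ^ 2 * (ν * z) = 4 * (α * z) := by
        linear_combination (4 * α * z) * hαν
      linarith
    have h2 : 2 * α * tr ≤ γ / 2 := by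
      have := mul_le_mul_of_nonneg_left htr (by positivity : 0 ≤ 2 * α)
      have h3 : 2 * α * (n / ν) = γ / 2 := by rw [hα, hγ]; field_simp; norm_num
      linarith
    have h3 : Real.exp (-α * R) = Real.exp (-α * z) * Real.exp (-(α * (R - z))) := by
      rw [← Real.exp_add]; ring_nf
    have hE := Real.exp_pos (-α * z)
    have h4 : 2 * Real.exp (-(α * (R - z))) * γ ≤ 3 * (α * z) + γ / 2 := by
      by_cases hz2 : z ≤ R / 2
      · have h5 : 3 ≤ α * (R - z) := by nlinarith
        have h6 := mul_le_mul_of_nonneg_right (e1 _ h5) hγ0.le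
        have h7 : 0 ≤ α * z := by positivity
        linarith
      · push Not at hz2
        have h5 : Real.exp (-(α * (R - z))) ≤ 1 := by
          rw [Real.exp_le_one_iff]
          have := mul_nonneg hα0.le (by linarith : 0 ≤ R - z)
          linarith
        have h6 := mul_le_mul_of_nonneg_right h5 hγ0.le
        have h7 : z ≤ α * z := by nlinarith
        linarith
    rw [h3]
    have h5 := mul_le_mul_of_nonneg_left (by linarith :
      2 * Real.exp (-(α * (R - z))) * γ ≤ 4 * α ^ 2 * q - 2 * α * tr - α * z + γ) hE.le
    linarith
  · intro z q tr hz hq htr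
    have h1 : 4 * κ ^ 2 * q ≤ κ * z / 2 := by
      have := mul_le_mul_of_nonneg_left hq (by positivity : 0 ≤ 4 * κ ^ 2)
      have h2 : 4 * κ ^ 2 * (n / ν * z) = κ * z / 2 := by
        rw [hκ]; field_simp; ring
      linarith
    have h2 := mul_le_mul_of_nonneg_left hz hκ0.le
    have h3 : 0 ≤ 2 * κ * tr := by positivity
    linarith
  · intro z hz
    have h1 : 0 ≤ Real.exp (-α * z) - 2 * Real.exp (-α * R) := by
      have h3 : Real.exp (-α * R) = Real.exp (-α * z) * Real.exp (-(α * (R - z))) := by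
        rw [← Real.exp_add]; ring_nf
      have h5 : 3 ≤ α * (R - z) := by nlinarith
      have h6 := mul_le_mul_of_nonneg_left (e1 _ h5) (Real.exp_pos (-α * z)).le
      rw [h3]
      linarith [Real.exp_pos (-α * z)]
    refine ⟨?_, h1⟩
    have : 0 ≤ 2 * Real.exp (-α * R) * Real.exp (κ * (R / 2)) * Real.exp (-κ * z) := by positivity
    linarith
  · intro z hz
    have h1 : Real.exp (-α * z) ≤ Real.exp (-α * R) := by
      apply Real.exp_le_exp.mpr
      have := mul_le_mul_of_nonneg_left hz hα0.le
      linarith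
    have h2 : Real.exp (κ * (R / 2)) * Real.exp (-κ * z) ≤ 1 / 3 := by
      rw [← Real.exp_add]
      have := mul_le_mul_of_nonneg_left hz hκ0.le
      have := e2 (-(κ * (R / 2) + -κ * z)) (by linarith)
      rwa [neg_neg] at this
    have h3 := mul_le_mul_of_nonneg_left h2 hδ.le
    linarith [Real.exp_pos (-α * R)]


lemma barrier_ineq {n : ℕ} {ν : ℝ} (hν : ν ∈ Ioc (0 : ℝ) 1) {K α κ γ R δ c : ℝ}
    (hα : 0 < α) (hκ : 0 < κ) (hγ : 0 < γ) (hR : 0 < R) (hc : 0 < c)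
    (H1 : ∀ z q tr, 0 ≤ z → z ≤ R → ν * z ≤ q → tr ≤ n / ν →
        0 ≤ Real.exp (-α * z) * (4 * α ^ 2 * q - 2 * α * tr - α * z + γ) - δ * γ)
    (H2 : ∀ z q tr, R / 2 ≤ z → q ≤ n / ν * z → 0 ≤ tr → 4 * κ ^ 2 * q - 2 * κ * tr - κ * z + γ ≤ 0)
    (H3 : ∀ z, z ≤ R / 2 → -c * Real.exp (-κ * z) ≤ Real.exp (-α * z) - δ ∧ 0 ≤ Real.exp (-α * z) - δ)
    (H4 : ∀ z, R ≤ z → Real.exp (-α * z) - δ < -c * Real.exp (-κ * z))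
    (H5 : K ^ 2 ≤ R / 2) (hK : 1 ≤ K)
    {a : E n × ℝ → Fin n → Fin n → ℝ}
    (hco : IsParabolicCoeff ν a (closure (Cyl (univ : Set (E n)))))
    {ω : E n × ℝ → Measure (E n × ℝ)} (hω : IsCaloricMeasure a univ ω)
    {s : ℝ} (hs : 0 < s) {x : E n} {t : ℝ} (ht : 0 < t) (hx : ‖x‖ ≤ K * √t) :
    ∃ Φ : E n → ℝ, Continuous Φ ∧ (∃ M, ∀ y, |Φ y| ≤ M) ∧ 0 ≤ ∫ z, Φ z.1 ∂ω (x, t) ∧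
      ∀ y, Φ y = Real.exp (-γ * Real.log s) * max (Real.exp (-α * (‖y‖ ^ 2 / s)) - δ)
        (-c * Real.exp (-κ * (‖y‖ ^ 2 / s))) := by
  have hν0 := hν.1
  obtain ⟨V1, hV1⟩ : ∃ V1 : E n × ℝ → ℝ, V1 = bar 1 (-δ) α γ s := ⟨_, rfl⟩
  obtain ⟨V2, hV2⟩ : ∃ V2 : E n × ℝ → ℝ, V2 = bar (-c) 0 κ γ s := ⟨_, rfl⟩
  have hv1 : ∀ y τ, V1 (y, τ) = Real.exp (-γ * Real.log (τ + s)) *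
      (Real.exp (-α * (‖y‖ ^ 2 / (τ + s))) - δ) := by
    intro y τ; rw [hV1]; simp only [bar]; ring
  have hv2 : ∀ y τ, V2 (y, τ) = Real.exp (-γ * Real.log (τ + s)) *
      (-c * Real.exp (-κ * (‖y‖ ^ 2 / (τ + s)))) := by
    intro y τ; rw [hV2]; simp only [bar]; ring
  obtain ⟨Ψ, hΨ⟩ : ∃ Ψ : E n × ℝ → ℝ, Ψ = fun Y => max (V1 Y) (V2 Y) := ⟨_, rfl⟩
  have hΨc : ∀ Y : E n × ℝ, 0 ≤ Y.2 → ContinuousAt Ψ Y := by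
    intro Y hY
    rw [hΨ, hV1, hV2]
    exact (bar_cont _ _ _ _ _ Y (by linarith)).max (bar_cont _ _ _ _ _ Y (by linarith))
  obtain ⟨M, hMpos, hM⟩ : ∃ M, 0 < M ∧ ∀ Y : E n × ℝ, 0 ≤ Y.2 → |Ψ Y| ≤ M := by
    refine ⟨Real.exp (-γ * Real.log s) * (|1| + |-δ|) + Real.exp (-γ * Real.log s) * (|-c| + |0|),
      by positivity, ?_⟩
    intro Y hY
    have h1 := bar_abs (n := n) 1 (-δ) α γ s hα.le hγ.le hs Y hY
    have h2 := bar_abs (n := n) (-c) 0 κ γ s hκ.le hγ.le hs Y hY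
    rw [← hV1] at h1
    rw [← hV2] at h2
    rw [hΨ]
    refine abs_max_le_max_abs_abs.trans (max_le ?_ ?_)
    · linarith [abs_nonneg (V2 Y)]
    · linarith [abs_nonneg (V1 Y)]
  obtain ⟨Φ, hΦ⟩ : ∃ Φ : E n → ℝ, Φ = fun y => Ψ (y, 0) := ⟨_, rfl⟩
  have hΦc : Continuous Φ := by
    rw [hΦ, continuous_iff_continuousAt]
    intro y
    exact ContinuousAt.comp (f := fun y : E n => (y, (0:ℝ))) (hΨc (y, 0) le_rfl) (by fun_prop)
  have hΦM : ∀ y, |Φ y| ≤ M := fun y => by rw [hΦ]; exact hM (y, 0) le_rfl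
  obtain ⟨hprob, hext⟩ := hω
  obtain ⟨hsol, hbdry⟩ := hext (fun z => Φ z.1) (hΦc.comp continuous_fst) ⟨M, fun z => hΦM z.1⟩
  have hUM : ∀ X ∈ Cyl (univ : Set (E n)), |∫ z, Φ z.1 ∂ω X| ≤ M := by
    intro X hX
    have := (hprob X hX).1
    have h1 := norm_integral_le_of_norm_le_const (μ := ω X) (f := fun z => Φ z.1) (C := M)
      (Eventually.of_forall fun z => by rw [Real.norm_eq_abs]; exact hΦM z.1)
    simpa using h1
  have hcomp := comparison hν hco hsol hMpos hUM
    (Ψ := Ψ) (fun X hX => hM X (le_of_lt hX.2)) (fun X hX => hΨc X (le_of_lt hX.2))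
    (by
      intro y
      have h1 := hbdry (y, 0) (by simp [pBFrom])
      have h2 : Tendsto Ψ (nhdsWithin (y, 0) (Cyl univ)) (nhds (Ψ (y, 0))) :=
        (hΨc (y, 0) le_rfl).tendsto.mono_left nhdsWithin_le_nhds
      have h3 := h1.sub h2
      simp only [hΦ, sub_self] at h3 ⊢
      exact h3)
    (by
      intro y τ hτ
      have hT : 0 < τ + s := by linarith
      have hcl : (y, τ) ∈ closure (Cyl (univ : Set (E n))) := subset_closure (mem_Q.mpr hτ)
      obtain ⟨b1, b2, b3, b4⟩ := form_bounds hν (hco.2 _ hcl).1 (hco.2 _ hcl).2 y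
      have hG := Real.exp_pos (-γ * Real.log (τ + s))
      have hz0 : 0 ≤ ‖y‖ ^ 2 / (τ + s) := by positivity
      have c1 : ν * (‖y‖ ^ 2 / (τ + s)) ≤ (∑ i, ∑ j, a (y, τ) i j * y i * y j) / (τ + s) := by
        rw [← mul_div_assoc]; gcongr
      have c2 : (∑ i, ∑ j, a (y, τ) i j * y i * y j) / (τ + s) ≤ n / ν * (‖y‖ ^ 2 / (τ + s)) := by
        rw [← mul_div_assoc]; gcongr
      by_cases hcase : V2 (y, τ) ≤ V1 (y, τ)
      · have hzR : ‖y‖ ^ 2 / (τ + s) ≤ R := by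
          by_contra hcon
          push Not at hcon
          have h1 := mul_lt_mul_of_pos_left (H4 _ hcon.le) hG
          rw [hv1, hv2] at hcase
          linarith
        have hL := bar_LVal a 1 (-δ) α γ s y τ hT
        rw [← hV1] at hL
        refine ⟨V1, hL.1, ?_, ?_, ?_⟩
        · rw [hL.2]
          refine mul_nonneg (by positivity) ?_
          have := H1 _ _ _ hz0 hzR c1 b4
          linarith
        · rw [hΨ]; exact (max_eq_left hcase).symm
        · intro Y _; rw [hΨ]; exact le_max_left _ _
      · push Not at hcase
        have hzR : R / 2 ≤ ‖y‖ ^ 2 / (τ + s) := by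
          by_contra hcon
          push Not at hcon
          have h1 := mul_le_mul_of_nonneg_left (H3 _ hcon.le).1 hG.le
          rw [hv1, hv2] at hcase
          linarith
        have hL := bar_LVal a (-c) 0 κ γ s y τ hT
        rw [← hV2] at hL
        refine ⟨V2, hL.1, ?_, ?_, ?_⟩
        · rw [hL.2]
          refine mul_nonneg (by positivity) ?_
          have h1 := H2 _ _ _ hzR c2 b3
          have h2 : 0 < c * Real.exp (-κ * (‖y‖ ^ 2 / (τ + s))) := by positivity
          have h3 := mul_nonneg h2.le (neg_nonneg.mpr h1)
          linarith
        · rw [hΨ]; exact (max_eq_right hcase.le).symm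
        · intro Y _; rw [hΨ]; exact le_max_right _ _)
    (x, t) (mem_Q.mpr ht)
  refine ⟨Φ, hΦc, ⟨M, hΦM⟩, ?_, ?_⟩
  · refine le_trans ?_ hcomp
    have hz : ‖x‖ ^ 2 / (t + s) ≤ R / 2 := by
      refine le_trans ?_ H5
      rw [div_le_iff₀ (by linarith)]
      have h1 : ‖x‖ ^ 2 ≤ (K * √t) ^ 2 := by gcongr
      rw [mul_pow, Real.sq_sqrt ht.le] at h1
      have h2 : 0 ≤ K ^ 2 * s := by positivity
      linarith
    rw [hΨ]
    refine le_trans ?_ (le_max_left _ _)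
    rw [hv1]
    exact mul_nonneg (Real.exp_pos _).le (H3 _ hz).2
  · intro y
    rw [hΦ, hΨ]
    simp only
    rw [hv1, hv2, zero_add, mul_max_of_nonneg _ _ (Real.exp_pos _).le]


/-- **Theorem 1.1** (doubling property of the `L`-caloric measure in
`Q = ℝⁿ × (0,∞)`): for every `K ≥ 1` there is `N = N(n, ν, K)` such that for all
`r > 0` and `X = (x,t) ∈ Q` with `|x| ≤ K√t`,
`ω^X(Δ_{2r}) ≤ N ω^X(Δ_r)` where `Δ_r = B_r(0) × {0}`. -/
theorem doubling_whole_space (n : ℕ) (hn : 1 ≤ n) (ν : ℝ) (hν : ν ∈ Ioc (0 : ℝ) 1)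
    (K : ℝ) (hK : 1 ≤ K) :
    ∃ N : ℝ, 0 < N ∧
      ∀ (a : E n × ℝ → Fin n → Fin n → ℝ),
        IsParabolicCoeff ν a (closure (Cyl (univ : Set (E n)))) →
      ∀ ω : E n × ℝ → Measure (E n × ℝ), IsCaloricMeasure a univ ω →
      ∀ r : ℝ, 0 < r → ∀ x : E n, ∀ t : ℝ, 0 < t → ‖x‖ ≤ K * Real.sqrt t →
        ω (x, t) (ball (0 : E n) (2 * r) ×ˢ {(0 : ℝ)}) ≤
          ENNReal.ofReal N * ω (x, t) (ball (0 : E n) r ×ˢ {(0 : ℝ)}) := by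
  obtain ⟨α, κ, γ, R, δ, c, hα, hκ, hγ, hR, hδ, hc, H1, H2, H3, H4, H5⟩ := barrier_data n hn ν hν K
  obtain ⟨m, hm⟩ : ∃ m, m = c * Real.exp (-κ * (4 * R)) := ⟨_, rfl⟩
  have hm0 : 0 < m := by rw [hm]; positivity
  refine ⟨1 + 1 / m, by positivity, ?_⟩
  intro a hco ω hω r hr x t ht hx
  have hs : 0 < r ^ 2 / R := by positivity
  obtain ⟨Φ, hΦc, ⟨M, hΦM⟩, hIntg, hΦ⟩ :=
    barrier_ineq hν hα hκ hγ hR hc H1 H2 H3 H4 H5 hK hco hω hs ht hx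
  obtain ⟨G, hG⟩ : ∃ G, G = Real.exp (-γ * Real.log (r ^ 2 / R)) := ⟨_, rfl⟩
  have hG0 : 0 < G := by rw [hG]; positivity
  rw [← hG] at hΦ
  obtain ⟨hprob, hsupp⟩ := hω.1 (x, t) (mem_Q.mpr ht)
  generalize ω (x, t) = μ at *
  obtain ⟨A, hA⟩ : ∃ A, A = ball (0 : E n) r ×ˢ {(0 : ℝ)} := ⟨_, rfl⟩
  obtain ⟨B, hB⟩ : ∃ B, B = ball (0 : E n) (2 * r) ×ˢ {(0 : ℝ)} := ⟨_, rfl⟩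
  rw [← hA, ← hB]
  have hAm : MeasurableSet A := hA ▸ measurableSet_ball.prod (measurableSet_singleton _)
  have hBm : MeasurableSet B := hB ▸ measurableSet_ball.prod (measurableSet_singleton _)
  have hAB : A ⊆ B := by
    rw [hA, hB]; exact prod_mono (ball_subset_ball (by linarith)) subset_rfl
  have hΦ1 : ∀ y, Φ y ≤ G := by
    intro y
    rw [hΦ]
    have h1 : max (Real.exp (-α * (‖y‖ ^ 2 / (r ^ 2 / R))) - δ)
        (-c * Real.exp (-κ * (‖y‖ ^ 2 / (r ^ 2 / R)))) ≤ 1 := by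
      refine max_le ?_ ?_
      · have : Real.exp (-α * (‖y‖ ^ 2 / (r ^ 2 / R))) ≤ 1 := by
          rw [Real.exp_le_one_iff]
          have : 0 ≤ α * (‖y‖ ^ 2 / (r ^ 2 / R)) := by positivity
          linarith
        linarith
      · have : 0 < c * Real.exp (-κ * (‖y‖ ^ 2 / (r ^ 2 / R))) := by positivity
        linarith
    have := mul_le_mul_of_nonneg_left h1 hG0.le
    linarith
  have hΦ2 : ∀ y : E n, r ≤ ‖y‖ → Φ y = G * (-c * Real.exp (-κ * (‖y‖ ^ 2 / (r ^ 2 / R)))) := by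
    intro y hy
    have hz : R ≤ ‖y‖ ^ 2 / (r ^ 2 / R) := by
      rw [le_div_iff₀ hs, mul_div_cancel₀ _ hR.ne']
      gcongr
    rw [hΦ, max_eq_right (H4 _ hz).le]
  have hΦ3 : ∀ y : E n, r ≤ ‖y‖ → Φ y ≤ 0 := by
    intro y hy
    rw [hΦ2 y hy]
    have : 0 < G * (c * Real.exp (-κ * (‖y‖ ^ 2 / (r ^ 2 / R)))) := by positivity
    linarith
  have hΦ4 : ∀ y : E n, r ≤ ‖y‖ → ‖y‖ < 2 * r → Φ y ≤ -(G * m) := by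
    intro y hy hy2
    have hz : ‖y‖ ^ 2 / (r ^ 2 / R) ≤ 4 * R := by
      rw [div_le_iff₀ hs]
      have h1 : 4 * R * (r ^ 2 / R) = (2 * r) ^ 2 := by field_simp; norm_num
      rw [h1]
      gcongr
    have h2 : Real.exp (-κ * (4 * R)) ≤ Real.exp (-κ * (‖y‖ ^ 2 / (r ^ 2 / R))) := by
      apply Real.exp_le_exp.mpr
      have := mul_le_mul_of_nonneg_left hz hκ.le
      linarith
    rw [hΦ2 y hy, hm]
    have h3 := mul_le_mul_of_nonneg_left (mul_le_mul_of_nonneg_left h2 hc.le) hG0.le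
    linarith
  have hle : ∫ z, Φ z.1 ∂μ ≤
      ∫ z, (A.indicator (fun _ => G) z + (B \ A).indicator (fun _ => -(G * m)) z) ∂μ := by
    refine integral_mono_ae ?_ ?_ ?_
    · refine Integrable.of_bound (hΦc.comp continuous_fst).aestronglyMeasurable M ?_
      exact Eventually.of_forall fun z => by rw [Real.norm_eq_abs]; exact hΦM z.1
    · exact ((integrable_const G).indicator hAm).add
        ((integrable_const (-(G * m))).indicator (hBm.diff hAm))
    · have hae : ∀ᵐ z ∂μ, z ∈ pBFrom (univ : Set (E n)) 0 := by
        rw [ae_iff]; exact hsupp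
      filter_upwards [hae] with z hz
      obtain ⟨y, τ⟩ := z
      have hτ : τ = 0 := by simpa [pBFrom] using hz
      subst hτ
      have hyA : (y, (0:ℝ)) ∈ A ↔ ‖y‖ < r := by rw [hA]; simp
      have hyB : (y, (0:ℝ)) ∈ B ↔ ‖y‖ < 2 * r := by rw [hB]; simp
      by_cases h1 : ‖y‖ < r
      · rw [indicator_of_mem (hyA.mpr h1), indicator_of_notMem (fun h => h.2 (hyA.mpr h1)), add_zero]
        exact hΦ1 y
      · rw [indicator_of_notMem (fun h => h1 (hyA.mp h)), zero_add]
        push Not at h1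
        by_cases h2 : ‖y‖ < 2 * r
        · rw [indicator_of_mem (show (y, (0:ℝ)) ∈ B \ A from
            ⟨hyB.mpr h2, fun h => absurd (hyA.mp h) (not_lt.mpr h1)⟩)]
          exact hΦ4 y h1 h2
        · rw [indicator_of_notMem (fun h => h2 (hyB.mp h.1))]
          exact hΦ3 y h1
  rw [integral_add ((integrable_const G).indicator hAm)
    ((integrable_const (-(G * m))).indicator (hBm.diff hAm)),
    integral_indicator_const _ hAm, integral_indicator_const _ (hBm.diff hAm)] at hle
  simp only [smul_eq_mul] at hle
  have hd : μ.real B = μ.real A + μ.real (B \ A) := by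
    rw [← measureReal_union disjoint_sdiff_right (hBm.diff hAm), union_sdiff_cancel hAB]
  have h1 : 0 ≤ G * (μ.real A - m * μ.real (B \ A)) := by linarith
  have h2 : m * μ.real (B \ A) ≤ μ.real A := by
    have := nonneg_of_mul_nonneg_right h1 hG0
    linarith
  have h3 : μ.real B ≤ (1 + 1 / m) * μ.real A := by
    have : μ.real (B \ A) ≤ μ.real A / m := by
      rw [le_div_iff₀ hm0]; linarith
    have h4 : (1 + 1 / m) * μ.real A = μ.real A + μ.real A / m := by ring
    rw [hd, h4]; linarith
  rw [← ofReal_measureReal (μ := μ) (s := B), ← ofReal_measureReal (μ := μ) (s := A),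
    ← ENNReal.ofReal_mul (by positivity)]
  exact ENNReal.ofReal_le_ofReal h3
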